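/- arXiv:2001.10706 — 2 statements merged into one kernel-verified Lean document; each statement's English description precedes it below -/
import Mathlib

section
/- Let n+1 ≤ k ≤ 2n², let u_1,…,u_k ∈ S^{n−1} and c_1,…,c_k > 0 satisfy Σ_{i=1}^k c_i u_i⊗u_i = Id_n and Σ_{i=1}^k c_i u_i = 0, and suppose ℓ(C°) ≤ (1+ε)ℓ(Δ_n°) holds for C = conv{u_1,…,u_k} and some ε ∈ (0, n^{−60n}). Then, with η = n^{15n}·ε^{1/4} ∈ (0,1), there exist unit vectors w_1,…,w_{n+1} ∈ S^{n−1} forming the vertices of a regular simplex (pairwise inner products −1/n) and indices {i_1,…,i_{n+1}} ⊆ {1,…,k} such that ∠(u_{i_j}, w_j) ≤ η for j = 1,…,n+1. -/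
open MeasureTheory Metric Set
open scoped RealInnerProductSpace ENNReal

noncomputable section

/-- The standard Gaussian measure `γ_n` on `ℝ^n`. -/
def gaussianM (n : ℕ) : Measure (EuclideanSpace ℝ (Fin n)) :=
  volume.withDensity fun x =>
    ENNReal.ofReal ((2 * Real.pi) ^ (-(n : ℝ) / 2) * Real.exp (-‖x‖ ^ 2 / 2))

/-- The ℓ-norm of a convex body: `ℓ(K) = ∫ ‖x‖_K dγ_n(x)`, where `‖·‖_K` is the gauge of `K`. -/
def ellNorm (n : ℕ) (K : Set (EuclideanSpace ℝ (Fin n))) : ℝ :=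
  ∫ x, gauge K x ∂(gaussianM n)

/-- The support function `h_K`. -/
def suppFn {n : ℕ} (K : Set (EuclideanSpace ℝ (Fin n))) (u : EuclideanSpace ℝ (Fin n)) : ℝ :=
  sSup ((fun y => ⟪u, y⟫) '' K)

/-- The mean width `W(K) = (1/(n κ_n)) ∫_{S^{n-1}} (h_K(u) + h_K(-u)) du`, the integration over
the unit sphere being with respect to the (n-1)-dimensional Hausdorff measure. -/
def meanWidth (n : ℕ) (K : Set (EuclideanSpace ℝ (Fin n))) : ℝ :=
  (1 / (n * (volume (closedBall (0 : EuclideanSpace ℝ (Fin n)) 1)).toReal)) *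
    ∫ u in sphere (0 : EuclideanSpace ℝ (Fin n)) 1,
      (suppFn K u + suppFn K (-u)) ∂(μH[(n : ℝ) - 1])

/-- The polar set `K° = {x : ⟨x,y⟩ ≤ 1 for all y ∈ K}`. -/
def polarSet {n : ℕ} (K : Set (EuclideanSpace ℝ (Fin n))) : Set (EuclideanSpace ℝ (Fin n)) :=
  {x | ∀ y ∈ K, ⟪x, y⟫ ≤ 1}

/-- `w` lists the vertices of a regular simplex inscribed in the unit ball: `n+1` unit vectors
with pairwise inner products `-1/n`. -/
def IsRegVerts {n : ℕ} (w : Fin (n + 1) → EuclideanSpace ℝ (Fin n)) : Prop :=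
  (∀ i, ‖w i‖ = 1) ∧ ∀ i j, i ≠ j → ⟪w i, w j⟫ = -1 / n

/-- An ellipsoid: an image of the closed Euclidean unit ball under an invertible affine map. -/
def IsEllipsoid {n : ℕ} (D : Set (EuclideanSpace ℝ (Fin n))) : Prop :=
  ∃ f : EuclideanSpace ℝ (Fin n) ≃ᵃ[ℝ] EuclideanSpace ℝ (Fin n),
    D = f '' closedBall 0 1

/-- `D` is the Löwner ellipsoid (minimal volume ellipsoid containing) of `K`. -/
def IsLoewnerEllipsoid {n : ℕ} (D K : Set (EuclideanSpace ℝ (Fin n))) : Prop :=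
  IsEllipsoid D ∧ K ⊆ D ∧ ∀ D', IsEllipsoid D' → K ⊆ D' → volume D ≤ volume D'

/-- `D` is the John ellipsoid (maximal volume ellipsoid contained in) of `K`. -/
def IsJohnEllipsoid {n : ℕ} (D K : Set (EuclideanSpace ℝ (Fin n))) : Prop :=
  IsEllipsoid D ∧ D ⊆ K ∧ ∀ D', IsEllipsoid D' → D' ⊆ K → volume D' ≤ volume D

open ProbabilityTheory

section
/-- standard normal density -/
def gphi (x : ℝ) : ℝ := (√(2 * Real.pi))⁻¹ * Real.exp (-x ^ 2 / 2)

/-- standard normal distribution function -/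
def gPhi (x : ℝ) : ℝ := ∫ y in Iic x, gphi y

lemma gphi_eq : gphi = gaussianPDFReal 0 1 := by
  funext x; simp [gphi, gaussianPDFReal]

lemma gphi_pos (x : ℝ) : 0 < gphi x := by unfold gphi; positivity

lemma gphi_cont : Continuous gphi := by unfold gphi; fun_prop

lemma gphi_int : Integrable gphi := by
  rw [gphi_eq]; exact integrable_gaussianPDFReal 0 1

lemma gPhi_sub (a b : ℝ) : gPhi b - gPhi a = ∫ y in a..b, gphi y :=
  intervalIntegral.integral_Iic_sub_Iic gphi_int.integrableOn gphi_int.integrableOn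

lemma gPhi_hasDeriv (x : ℝ) : HasDerivAt gPhi (gphi x) x := by
  have h : gPhi = fun b => gPhi 0 + ∫ y in (0:ℝ)..b, gphi y := by
    funext b; rw [← gPhi_sub]; ring
  rw [h]
  exact (intervalIntegral.integral_hasDerivAt_right (gphi_cont.intervalIntegrable _ _)
    (gphi_cont.stronglyMeasurableAtFilter _ _) gphi_cont.continuousAt).const_add _

lemma gPhi_strictMono : StrictMono gPhi :=
  strictMono_of_hasDerivAt_pos gPhi_hasDeriv gphi_pos

lemma gPhi_cont : Continuous gPhi :=
  continuous_iff_continuousAt.2 fun x => (gPhi_hasDeriv x).continuousAt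

lemma gPhi_meas (x : ℝ) : gaussianReal 0 1 (Iic x) = ENNReal.ofReal (gPhi x) := by
  rw [gaussianReal_apply_eq_integral 0 one_ne_zero, ← gphi_eq]; rfl

lemma gPhi_cdf : gPhi = cdf (gaussianReal 0 1) := by
  funext x
  rw [cdf_eq_real, Measure.real, gPhi_meas, ENNReal.toReal_ofReal]
  exact setIntegral_nonneg measurableSet_Iic fun y _ => (gphi_pos y).le

lemma gPhi_top : Filter.Tendsto gPhi Filter.atTop (nhds 1) := by
  rw [gPhi_cdf]; exact tendsto_cdf_atTop _

lemma gPhi_bot : Filter.Tendsto gPhi Filter.atBot (nhds 0) := by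
  rw [gPhi_cdf]; exact tendsto_cdf_atBot _

lemma gPhi_pos (x : ℝ) : 0 < gPhi x := by
  have h : gPhi (x - 1) < gPhi x := gPhi_strictMono (by linarith)
  have : 0 ≤ gPhi (x - 1) := by rw [gPhi_cdf]; exact cdf_nonneg _ _
  linarith

lemma gPhi_lt_one (x : ℝ) : gPhi x < 1 := by
  have h : gPhi x < gPhi (x + 1) := gPhi_strictMono (by linarith)
  have : gPhi (x + 1) ≤ 1 := by rw [gPhi_cdf]; exact cdf_le_one _ _
  linarith

lemma gPhi_zero : gPhi 0 = 1 / 2 := by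
  have h1 : ∫ y in Ioi (0:ℝ), gphi y = gPhi 0 := by
    have := integral_comp_neg_Iic (0:ℝ) gphi
    rw [neg_zero] at this
    rw [← this]
    simp [gPhi, gphi]
  have h2 := intervalIntegral.integral_Iic_add_Ioi (b := (0:ℝ)) (gphi_int.integrableOn)
    (gphi_int.integrableOn)
  rw [h1] at h2
  have h3 : ∫ y, gphi y = 1 := by rw [gphi_eq]; exact integral_gaussianPDFReal_eq_one 0 one_ne_zero
  have : gPhi 0 + gPhi 0 = 1 := by rw [← h3, ← h2]; rfl
  linarith

lemma gphi_anti {a b : ℝ} (ha : 0 ≤ a) (hab : a ≤ b) : gphi b ≤ gphi a := by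
  unfold gphi
  gcongr

lemma gphi_le_zero (x : ℝ) : gphi x ≤ gphi 0 := by
  unfold gphi
  apply mul_le_mul_of_nonneg_left _ (by positivity)
  apply Real.exp_le_exp.2
  nlinarith [sq_nonneg x]

lemma gphi_zero_le : gphi 0 ≤ 2 / 5 := by
  unfold gphi
  simp only [ne_eq, OfNat.ofNat_ne_zero, not_false_eq_true, zero_pow, neg_zero, zero_div,
    Real.exp_zero, mul_one]
  rw [inv_le_comm₀ (by positivity) (by norm_num)]
  apply Real.le_sqrt_of_sq_le
  nlinarith [Real.pi_gt_d6]

lemma gphi_zero_ge : 39 / 100 ≤ gphi 0 := by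
  unfold gphi
  simp only [ne_eq, OfNat.ofNat_ne_zero, not_false_eq_true, zero_pow, neg_zero, zero_div,
    Real.exp_zero, mul_one]
  rw [le_inv_comm₀ (by norm_num) (by positivity), Real.sqrt_le_left (by norm_num)]
  nlinarith [Real.pi_lt_d6]

lemma gphi_eq_mul (x : ℝ) : gphi x = gphi 0 * Real.exp (-x ^ 2 / 2) := by
  simp [gphi]

/-- upper Lipschitz bound -/
lemma gPhi_sub_le {a b : ℝ} (hab : a ≤ b) : gPhi b - gPhi a ≤ 2 / 5 * (b - a) := by
  have := Convex.image_sub_le_mul_sub_of_deriv_le (f := gPhi) convex_univ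
    gPhi_cont.continuousOn (fun x _ => (gPhi_hasDeriv x).differentiableAt.differentiableWithinAt)
    (C := 2/5) (fun x _ => by
      rw [(gPhi_hasDeriv x).deriv]; exact (gphi_le_zero x).trans gphi_zero_le)
    a (mem_univ _) b (mem_univ _) hab
  exact this

lemma gPhi_sub_ge {a b : ℝ} (ha : 0 ≤ a) (hab : a ≤ b) : gphi b * (b - a) ≤ gPhi b - gPhi a := by
  have := Convex.mul_sub_le_image_sub_of_le_deriv (f := gPhi) (convex_Icc a b)
    gPhi_cont.continuousOn (fun x _ => (gPhi_hasDeriv x).differentiableAt.differentiableWithinAt)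
    (C := gphi b) (fun x hx => by
      rw [(gPhi_hasDeriv x).deriv]
      rw [interior_Icc] at hx
      exact gphi_anti (ha.trans hx.1.le) hx.2.le)
    a (left_mem_Icc.2 hab) b (right_mem_Icc.2 hab) hab
  exact this

lemma gPhi_one_le : gPhi 1 ≤ 19 / 20 := by
  have h := gPhi_sub_ge (a := 1) (b := 2) (by norm_num) (by norm_num)
  have h2 := gPhi_lt_one 2
  have h3 : 39/100 * (13/100) ≤ gphi 2 := by
    rw [gphi_eq_mul]
    apply mul_le_mul gphi_zero_ge _ (by norm_num) (gphi_pos 0).le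
    have : Real.exp (-2 ^ 2 / 2) = (Real.exp 1 ^ 2)⁻¹ := by
      rw [← Real.exp_nat_mul, ← Real.exp_neg]; norm_num
    rw [this, le_inv_comm₀ (by norm_num) (by positivity)]
    have := Real.exp_one_lt_d9
    have := Real.exp_pos 1
    nlinarith
  linarith

lemma gPhi_half_ge : 67 / 100 ≤ gPhi (1 / 2) := by
  have h := gPhi_sub_ge (a := 0) (b := 1/2) (by norm_num) (by norm_num)
  have h3 : 39/100 * (7/8) ≤ gphi (1/2) := by
    rw [gphi_eq_mul]
    apply mul_le_mul gphi_zero_ge _ (by norm_num) (gphi_pos 0).le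
    have := Real.add_one_le_exp (-(1/2 : ℝ) ^ 2 / 2)
    norm_num at this ⊢
    linarith
  rw [gPhi_zero] at h
  linarith

lemma gPhi_one_ge : 76 / 100 ≤ gPhi 1 := by
  have h := gPhi_sub_ge (a := 1/2) (b := 1) (by norm_num) (by norm_num)
  have h3 : 39/100 * (1/2) ≤ gphi 1 := by
    rw [gphi_eq_mul]
    apply mul_le_mul gphi_zero_ge _ (by norm_num) (gphi_pos 0).le
    have := Real.add_one_le_exp (-(1 : ℝ) ^ 2 / 2)
    norm_num at this ⊢
    linarith
  have := gPhi_half_ge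
  linarith

lemma gPhi_surj {p : ℝ} (h0 : 0 < p) (h1 : p < 1) : ∃ x, gPhi x = p :=
  mem_range_of_exists_le_of_exists_ge gPhi_cont
    ((gPhi_bot.eventually_le_const h0).exists) ((gPhi_top.eventually_const_le h1).exists)

/-- the transport of the normal law truncated at `l` to the normal law -/
lemma exists_transport (l : ℝ) : ∃ T : ℝ → ℝ, (∀ s < l, gPhi (T s) = gPhi s / gPhi l) ∧
    ∀ s < l, HasDerivAt T (Real.exp ((T s ^ 2 - s ^ 2) / 2) / gPhi l) s := by
  have hx : ∀ s : ℝ, ∃ x, s < l → gPhi x = gPhi s / gPhi l := by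
    intro s
    by_cases hs : s < l
    · obtain ⟨x, hx⟩ := gPhi_surj (p := gPhi s / gPhi l) (div_pos (gPhi_pos _) (gPhi_pos _))
        ((div_lt_one (gPhi_pos _)).2 (gPhi_strictMono hs))
      exact ⟨x, fun _ => hx⟩
    · exact ⟨0, fun h => absurd h hs⟩
  choose T hT using hx
  refine ⟨T, hT, fun s hs => ?_⟩
  have hcont : ContinuousAt T s := by
    rw [Metric.continuousAt_iff']
    intro e he
    have hc : ContinuousAt (fun s => gPhi s / gPhi l) s := (gPhi_cont.div_const _).continuousAt
    have h1 : gPhi (T s - e) < gPhi s / gPhi l := by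
      rw [← hT s hs]; exact gPhi_strictMono (by linarith)
    have h2 : gPhi s / gPhi l < gPhi (T s + e) := by
      rw [← hT s hs]; exact gPhi_strictMono (by linarith)
    filter_upwards [hc.eventually_const_lt h1, hc.eventually_lt_const h2, eventually_lt_nhds hs]
      with y hy1 hy2 hy3
    rw [← hT y hy3] at hy1 hy2
    have := gPhi_strictMono.lt_iff_lt.1 hy1
    have := gPhi_strictMono.lt_iff_lt.1 hy2
    rw [Real.dist_eq, abs_lt]; constructor <;> linarith
  have hslope : HasDerivAt T ((gphi (T s))⁻¹ * (gphi s / gPhi l)) s := by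
    have hd := gPhi_hasDeriv (T s)
    have hR : HasDerivAt (fun s => gPhi s / gPhi l) (gphi s / gPhi l) s := (gPhi_hasDeriv s).div_const _
    rw [hasDerivAt_iff_tendsto_slope] at hR ⊢
    have hT' : Filter.Tendsto T (nhdsWithin s {s}ᶜ) (nhdsWithin (T s) {T s}ᶜ) := by
      apply tendsto_nhdsWithin_of_tendsto_nhds_of_eventually_within
      · exact hcont.tendsto.mono_left nhdsWithin_le_nhds
      · have : ∀ᶠ y in nhdsWithin s {s}ᶜ, y < l := nhdsWithin_le_nhds (eventually_lt_nhds hs)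
        filter_upwards [this, self_mem_nhdsWithin] with y hy hys hTy
        apply hys
        have h1 := hT y hy
        rw [hTy, hT s hs, div_left_inj' (gPhi_pos l).ne'] at h1
        exact (gPhi_strictMono.injective h1).symm
    have h2 := (hasDerivAt_iff_tendsto_slope.1 hd).comp hT'
    have h3 := (h2.inv₀ (gphi_pos _).ne').mul hR
    refine h3.congr' ?_
    have : ∀ᶠ y in nhdsWithin s {s}ᶜ, y < l := nhdsWithin_le_nhds (eventually_lt_nhds hs)
    filter_upwards [this, self_mem_nhdsWithin, hT'.eventually self_mem_nhdsWithin] with y hy hys hTy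
    simp only [Function.comp, slope_def_field, hT y hy, hT s hs]
    have a1 : y - s ≠ 0 := sub_ne_zero.2 hys
    have a2 : gPhi y / gPhi l - gPhi s / gPhi l ≠ 0 := by
      rw [sub_ne_zero, Ne, div_left_inj' (gPhi_pos l).ne']
      exact fun h => hys (gPhi_strictMono.injective h)
    rw [inv_div, div_mul_div_cancel₀ a2]
  convert hslope using 1
  have e1 : Real.exp ((T s ^ 2 - s ^ 2) / 2) = gphi s / gphi (T s) := by
    unfold gphi
    rw [mul_div_mul_left _ _ (by positivity), ← Real.exp_sub]
    congr 1; ring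
  rw [e1]; field_simp


lemma transport_bounds {l : ℝ} (hl1 : 1 / 2 ≤ l) (hl2 : l ≤ 1) {T : ℝ → ℝ}
    (hT : ∀ s < l, gPhi (T s) = gPhi s / gPhi l)
    {s : ℝ} (hs : |s| ≤ 1 / 100) : 1 / 20 ≤ T s ∧ 1 ≤ Real.exp ((T s ^ 2 - s ^ 2) / 2) / gPhi l ∧
      Real.exp ((T s ^ 2 - s ^ 2) / 2) / gPhi l ≤ 3 := by
  obtain ⟨hs1, hs2⟩ := abs_le.1 hs
  have hsl : s < l := by linarith
  have hP := hT s hsl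
  have hl0 := gPhi_pos l
  have hlone := gPhi_lt_one l
  have hlle : gPhi l ≤ 19 / 20 := (gPhi_strictMono.monotone hl2).trans gPhi_one_le
  have hlge : 67 / 100 ≤ gPhi l := gPhi_half_ge.trans (gPhi_strictMono.monotone hl1)
  have hsge : 49 / 100 ≤ gPhi s := by
    have h1 := gPhi_sub_le (a := -(1/100)) (b := 0) (by norm_num)
    have h2 : gPhi (-(1/100)) ≤ gPhi s := gPhi_strictMono.monotone hs1
    rw [gPhi_zero] at h1
    linarith
  have hsle : gPhi s ≤ 505 / 1000 := by
    have h1 := gPhi_sub_le (a := 0) (b := 1/100) (by norm_num)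
    have h2 : gPhi s ≤ gPhi (1/100) := gPhi_strictMono.monotone hs2
    rw [gPhi_zero] at h1
    linarith
  rw [eq_div_iff hl0.ne'] at hP
  have hTP := gPhi_pos (T s)
  have hlt : s ≤ T s := by
    by_contra h
    push Not at h
    have := gPhi_strictMono h
    nlinarith
  have hT1 : 1 / 20 ≤ T s := by
    have h1 := gPhi_sub_le hlt
    nlinarith
  have hT2 : T s ≤ 1 := by
    by_contra h
    push Not at h
    have := gPhi_strictMono h
    have := gPhi_one_ge
    nlinarith
  refine ⟨hT1, ?_, ?_⟩
  · rw [le_div_iff₀ hl0, one_mul]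
    have : 1 ≤ Real.exp ((T s ^ 2 - s ^ 2) / 2) := Real.one_le_exp (by nlinarith)
    linarith
  · rw [div_le_iff₀ hl0]
    have h1 : Real.exp ((T s ^ 2 - s ^ 2) / 2) ≤ Real.exp (1/2) := by
      apply Real.exp_le_exp.2; nlinarith
    have h2 : Real.exp (1/2) ≤ 2 := by
      have h3 : Real.exp (1/2) * Real.exp (1/2) = Real.exp 1 := by rw [← Real.exp_add]; norm_num
      have := Real.exp_one_lt_d9
      nlinarith [Real.exp_pos (1/2)]
    linarith

lemma transport_sep {l : ℝ} (hl1 : 1 / 2 ≤ l) (hl2 : l ≤ 1) {T : ℝ → ℝ}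
    (hT : ∀ s < l, gPhi (T s) = gPhi s / gPhi l)
    (hT' : ∀ s < l, HasDerivAt T (Real.exp ((T s ^ 2 - s ^ 2) / 2) / gPhi l) s)
    {s s' : ℝ} (hs : |s| ≤ 1 / 100) (hs' : |s'| ≤ 1 / 100) :
    1 / 25 * |s - s'| ≤ |Real.exp ((T s ^ 2 - s ^ 2) / 2) / gPhi l -
      Real.exp ((T s' ^ 2 - s' ^ 2) / 2) / gPhi l| := by
  wlog h : s' ≤ s generalizing s s'
  · rw [abs_sub_comm, abs_sub_comm (Real.exp _ / _)]
    exact this hs' hs (by linarith)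
  obtain ⟨hs1, hs2⟩ := abs_le.1 hs
  obtain ⟨hs1', hs2'⟩ := abs_le.1 hs'
  have b := transport_bounds hl1 hl2 hT hs
  have b' := transport_bounds hl1 hl2 hT hs'
  have hsub : ∀ x ∈ Icc s' s, |x| ≤ 1/100 := fun x hx =>
    abs_le.2 ⟨hs1'.trans hx.1, hx.2.trans hs2⟩
  have hd : ∀ x ∈ Icc s' s, HasDerivAt T (Real.exp ((T x ^ 2 - x ^ 2) / 2) / gPhi l) x := fun x hx =>
    hT' x (by linarith [hx.2])
  have hmv := Convex.mul_sub_le_image_sub_of_le_deriv (f := T) (convex_Icc s' s)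
    (fun x hx => (hd x hx).continuousAt.continuousWithinAt)
    (fun x hx => (hd x (interior_subset hx)).differentiableAt.differentiableWithinAt)
    (C := 1) (fun x hx => by
      rw [(hd x (interior_subset hx)).deriv]
      exact (transport_bounds hl1 hl2 hT (hsub x (interior_subset hx))).2.1)
    s' (left_mem_Icc.2 h) s (right_mem_Icc.2 h) h
  rw [one_mul] at hmv
  have hexp : Real.exp ((T s ^ 2 - s ^ 2) / 2) / gPhi l = Real.exp ((T s' ^ 2 - s' ^ 2) / 2) / gPhi l *
      Real.exp ((T s ^ 2 - s ^ 2) / 2 - (T s' ^ 2 - s' ^ 2) / 2) := by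
    rw [div_mul_eq_mul_div, ← Real.exp_add]; congr 2; ring
  have h1 : 1 / 25 * (s - s') ≤ (T s ^ 2 - s ^ 2) / 2 - (T s' ^ 2 - s' ^ 2) / 2 := by
    have e1 : (1/10) * (s - s') ≤ (T s + T s') * (T s - T s') := by
      apply mul_le_mul _ hmv (by linarith) (by linarith [b.1, b'.1])
      linarith [b.1, b'.1]
    nlinarith
  have h2 := Real.add_one_le_exp ((T s ^ 2 - s ^ 2) / 2 - (T s' ^ 2 - s' ^ 2) / 2)
  rw [abs_of_nonneg (by linarith : 0 ≤ s - s')]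
  refine le_trans ?_ (le_abs_self _)
  rw [hexp]
  nlinarith [b'.2.1]
end

section
section detpart
variable {V : Type*} [NormedAddCommGroup V] [InnerProductSpace ℝ V] [FiniteDimensional ℝ V]
  {ι : Type*} [Fintype ι]

/-- the operator `∑ c_i t_i v_i ⊗ v_i` -/
def frameOp (c t : ι → ℝ) (v : ι → V) : V →L[ℝ] V :=
  ∑ i, (c i * t i) • (innerSL ℝ (v i)).smulRight (v i)

lemma frameOp_apply (c t : ι → ℝ) (v : ι → V) (x : V) :
    frameOp c t v x = ∑ i, (c i * t i * ⟪v i, x⟫) • v i := by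
  simp [frameOp, smul_smul]

lemma frameOp_inner (c t : ι → ℝ) (v : ι → V) (x y : V) :
    ⟪frameOp c t v x, y⟫ = ∑ i, c i * t i * ⟪v i, x⟫ * ⟪v i, y⟫ := by
  simp [frameOp_apply, sum_inner, inner_smul_left]

lemma frameOp_symm (c t : ι → ℝ) (v : ι → V) :
    (frameOp c t v : V →ₗ[ℝ] V).IsSymmetric := by
  intro x y
  rw [real_inner_comm _ x]
  simp only [ContinuousLinearMap.coe_coe, frameOp_inner]
  exact Finset.sum_congr rfl fun i _ => by ring

lemma sqrt_ineq {y : ℝ} (hy : 0 < y) : (√y - 1) ^ 2 ≤ y - 1 - Real.log y := by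
  have h := Real.log_le_sub_one_of_pos (Real.sqrt_pos.2 hy)
  rw [Real.log_sqrt hy.le] at h
  nlinarith [Real.sq_sqrt hy.le]

lemma sqrt_ineq3 {t σ : ℝ} (ht : 1 ≤ t) (ht' : t ≤ 3) (hs : 1 ≤ σ) (hs' : σ ≤ 3) :
    (t - σ) ^ 2 / 144 ≤ t / σ - 1 - Real.log (t / σ) := by
  have hσ : 0 < σ := by linarith
  have hpos : 0 < t / σ := by positivity
  refine le_trans ?_ (sqrt_ineq hpos)
  have h2 := Real.sq_sqrt hpos.le
  have h0 := Real.sqrt_nonneg (t / σ)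
  have h3 : t / σ ≤ 3 := by rw [div_le_iff₀ hσ]; nlinarith
  have h4 : √(t/σ) ≤ 3 := by nlinarith
  have e : t - σ = σ * (√(t/σ) + 1) * (√(t/σ) - 1) := by
    have : σ * (√(t/σ) + 1) * (√(t/σ) - 1) = σ * (√(t/σ)^2 - 1) := by ring
    rw [this, h2]; field_simp
  have h5 : σ * (√(t/σ) + 1) ≤ 12 := by nlinarith
  have h6 : 0 ≤ σ * (√(t/σ) + 1) := by positivity
  rw [e, mul_pow]
  have : (σ * (√(t/σ) + 1))^2 ≤ 144 := by nlinarith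
  nlinarith [sq_nonneg (√(t/σ) - 1)]

/-- Ball and Barthe determinant identity with explicit remainder. -/
lemma frameOp_det (c t : ι → ℝ) (v : ι → V) (hv : ∀ i, ‖v i‖ = 1) 
    (hiso : ∀ x : V, ‖x‖ ^ 2 = ∑ i, c i * ⟪v i, x⟫ ^ 2) (hc : ∀ i, 0 ≤ c i) (ht : ∀ i, 0 < t i) :
    ∃ (e : OrthonormalBasis (Fin (Module.finrank ℝ V)) ℝ V) (σ : Fin (Module.finrank ℝ V) → ℝ),
      (∀ l, 0 < σ l) ∧ (∀ l, frameOp c t v (e l) = σ l • e l) ∧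
      (∀ l, σ l = ∑ i, c i * t i * ⟪v i, e l⟫ ^ 2) ∧
      (frameOp c t v).det = (∏ i, t i ^ c i) *
        Real.exp (∑ i, ∑ l, c i * ⟪v i, e l⟫ ^ 2 * (t i / σ l - 1 - Real.log (t i / σ l))) := by
  have hS := frameOp_symm c t v
  set e := hS.eigenvectorBasis rfl with he
  set σ := hS.eigenvalues rfl with hσdef
  have heig : ∀ l, frameOp c t v (e l) = σ l • e l := fun l => by
    exact hS.apply_eigenvectorBasis rfl l
  have hσ : ∀ l, σ l = ∑ i, c i * t i * ⟪v i, e l⟫ ^ 2 := fun l => by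
    have h1 : ⟪frameOp c t v (e l), e l⟫ = σ l := by
      rw [heig, inner_smul_left, real_inner_self_eq_norm_sq, e.norm_eq_one]; simp
    rw [← h1, frameOp_inner]
    exact Finset.sum_congr rfl fun i _ => by ring
  have hone : ∀ l, ∑ i, c i * ⟪v i, e l⟫ ^ 2 = 1 := fun l => by
    rw [← hiso, e.norm_eq_one]; norm_num
  have hone' : ∀ i, ∑ l, ⟪v i, e l⟫ ^ 2 = 1 := fun i => by
    rw [e.sum_sq_inner_left, hv]; norm_num
  have hσpos : ∀ l, 0 < σ l := by
    intro l
    have hnn : ∀ i, 0 ≤ c i * t i * ⟪v i, e l⟫ ^ 2 := fun i =>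
      mul_nonneg (mul_nonneg (hc i) (ht i).le) (sq_nonneg _)
    have h0 : 0 ≤ σ l := by rw [hσ]; exact Finset.sum_nonneg fun i _ => hnn i
    rcases h0.lt_or_eq with h | h
    · exact h
    · exfalso
      rw [hσ, eq_comm, Finset.sum_eq_zero_iff_of_nonneg (fun i _ => hnn i)] at h
      have := hone l
      rw [Finset.sum_eq_zero] at this
      · norm_num at this
      · intro i hi
        have := h i hi
        have ht' := (ht i).ne'
        rcases mul_eq_zero.1 this with h | h
        · rcases mul_eq_zero.1 h with h | h
          · simp [h]
          · exact absurd h ht'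
        · simp [h]
  refine ⟨e, σ, hσpos, heig, hσ, ?_⟩
  have hdet : (frameOp c t v).det = ∏ l, σ l := by
    have := hS.det_eq_prod_eigenvalues rfl
    simpa [ContinuousLinearMap.det] using this
  have hsum : ∑ i, ∑ l, c i * ⟪v i, e l⟫ ^ 2 * (t i / σ l - 1 - Real.log (t i / σ l)) =
      ∑ l, Real.log (σ l) - ∑ i, c i * Real.log (t i) := by
    have e1 : ∀ i l, c i * ⟪v i, e l⟫ ^ 2 * (t i / σ l - 1 - Real.log (t i / σ l)) =
        (c i * t i * ⟪v i, e l⟫ ^ 2) / σ l - c i * ⟪v i, e l⟫ ^ 2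
          - (c i * Real.log (t i)) * ⟪v i, e l⟫ ^ 2 + (c i * ⟪v i, e l⟫ ^ 2) * Real.log (σ l) := by
      intro i l
      rw [Real.log_div (ht i).ne' (hσpos l).ne']; ring
    simp_rw [e1, Finset.sum_add_distrib, Finset.sum_sub_distrib]
    have a1 : ∑ i, ∑ l, (c i * t i * ⟪v i, e l⟫ ^ 2) / σ l = ∑ l : Fin (Module.finrank ℝ V), (1:ℝ) := by
      rw [Finset.sum_comm]
      refine Finset.sum_congr rfl fun l _ => ?_
      rw [← Finset.sum_div, ← hσ, div_self (hσpos l).ne']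
    have a2 : ∑ i, ∑ l, c i * ⟪v i, e l⟫ ^ 2 = ∑ l : Fin (Module.finrank ℝ V), (1:ℝ) := by
      rw [Finset.sum_comm]
      exact Finset.sum_congr rfl fun l _ => hone l
    have a3 : ∑ i, ∑ l, (c i * Real.log (t i)) * ⟪v i, e l⟫ ^ 2 = ∑ i, c i * Real.log (t i) := by
      refine Finset.sum_congr rfl fun i _ => ?_
      rw [← Finset.mul_sum, hone', mul_one]
    have a4 : ∑ i, ∑ l, (c i * ⟪v i, e l⟫ ^ 2) * Real.log (σ l) = ∑ l, Real.log (σ l) := by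
      rw [Finset.sum_comm]
      refine Finset.sum_congr rfl fun l _ => ?_
      rw [← Finset.sum_mul, hone, one_mul]
    rw [a1, a2, a3, a4]; ring
  have hprod : ∏ i, t i ^ c i = Real.exp (∑ i, c i * Real.log (t i)) := by
    rw [Real.exp_sum]
    refine Finset.prod_congr rfl fun i _ => ?_
    rw [Real.rpow_def_of_pos (ht i), mul_comm]
  have hprod2 : ∏ l, σ l = Real.exp (∑ l, Real.log (σ l)) := by
    rw [Real.exp_sum]
    exact Finset.prod_congr rfl fun l _ => (Real.exp_log (hσpos l)).symm
  rw [hdet, hsum, hprod, hprod2, ← Real.exp_add]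
  congr 1; ring

lemma log_gap_nonneg {y : ℝ} (hy : 0 < y) : 0 ≤ y - 1 - Real.log y := by
  linarith [Real.log_le_sub_one_of_pos hy]

lemma frameOp_det_ge (c t : ι → ℝ) (v : ι → V) (hv : ∀ i, ‖v i‖ = 1) 
    (hiso : ∀ x : V, ‖x‖ ^ 2 = ∑ i, c i * ⟪v i, x⟫ ^ 2) (hc : ∀ i, 0 ≤ c i) (ht : ∀ i, 0 < t i) :
    ∏ i, t i ^ c i ≤ (frameOp c t v).det := by
  obtain ⟨e, σ, hσ, -, -, h⟩ := frameOp_det c t v hv hiso hc ht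
  rw [h]
  have hp : 0 ≤ ∏ i, t i ^ c i := Finset.prod_nonneg fun i _ => Real.rpow_nonneg (ht i).le _
  apply le_mul_of_one_le_right hp
  apply Real.one_le_exp
  exact Finset.sum_nonneg fun i _ => Finset.sum_nonneg fun l _ =>
    mul_nonneg (mul_nonneg (hc i) (sq_nonneg _)) (log_gap_nonneg (div_pos (ht i) (hσ l)))

lemma frameOp_det_stab (c t : ι → ℝ) (v : ι → V) (hv : ∀ i, ‖v i‖ = 1)
    (hiso : ∀ x : V, ‖x‖ ^ 2 = ∑ i, c i * ⟪v i, x⟫ ^ 2) (hc : ∀ i, 0 ≤ c i)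
    (ht : ∀ i, 1 ≤ t i) (ht3 : ∀ i, t i ≤ 3) {δ : ℝ} (hδ : 0 ≤ δ) {i j : ι} (hij : i ≠ j)
    (hi : δ ≤ c i) (hj : δ ≤ c j) :
    (∏ i, t i ^ c i) * (1 + δ / 288 * (⟪v i, v j⟫ ^ 2 * (t i - t j) ^ 2)) ≤
      (frameOp c t v).det := by
  have ht0 : ∀ i, 0 < t i := fun i => by linarith [ht i]
  obtain ⟨e, σ, hσ, heig, hσe, h⟩ := frameOp_det c t v hv hiso hc ht0
  have hone : ∀ l, ∑ i, c i * ⟪v i, e l⟫ ^ 2 = 1 := fun l => by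
    rw [← hiso, e.norm_eq_one]; norm_num
  have hσ1 : ∀ l, 1 ≤ σ l := fun l => by
    rw [← hone l, hσe]
    refine Finset.sum_le_sum fun i _ => ?_
    have := mul_nonneg (hc i) (sq_nonneg ⟪v i, e l⟫)
    nlinarith [ht i]
  have hσ3 : ∀ l, σ l ≤ 3 := fun l => by
    have : σ l ≤ ∑ i, 3 * (c i * ⟪v i, e l⟫ ^ 2) := by
      rw [hσe]
      refine Finset.sum_le_sum fun i _ => ?_
      have := mul_nonneg (hc i) (sq_nonneg ⟪v i, e l⟫)
      nlinarith [ht3 i]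
    rw [← Finset.mul_sum, hone] at this
    linarith
  have hnorm : ∀ i, ∑ l, ⟪v i, e l⟫ ^ 2 * (t i - σ l) ^ 2 =
      ‖t i • v i - frameOp c t v (v i)‖ ^ 2 := fun i => by
    rw [← e.sum_sq_inner_left]
    refine Finset.sum_congr rfl fun l _ => ?_
    have hs := frameOp_symm c t v (v i) (e l)
    simp only [ContinuousLinearMap.coe_coe] at hs
    rw [inner_sub_left, hs, heig, inner_smul_left, inner_smul_right]
    simp only [conj_trivial]; ring
  have hterm : ∀ i, c i / 144 * ‖t i • v i - frameOp c t v (v i)‖ ^ 2 ≤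
      ∑ l, c i * ⟪v i, e l⟫ ^ 2 * (t i / σ l - 1 - Real.log (t i / σ l)) := fun i => by
    rw [← hnorm, Finset.mul_sum]
    refine Finset.sum_le_sum fun l _ => ?_
    have := mul_le_mul_of_nonneg_left (sqrt_ineq3 (ht i) (ht3 i) (hσ1 l) (hσ3 l))
      (mul_nonneg (hc i) (sq_nonneg ⟪v i, e l⟫))
    calc _ = c i * ⟪v i, e l⟫ ^ 2 * ((t i - σ l) ^ 2 / 144) := by ring
      _ ≤ _ := this
  have hnn : ∀ i, 0 ≤ ∑ l, c i * ⟪v i, e l⟫ ^ 2 * (t i / σ l - 1 - Real.log (t i / σ l)) := fun i =>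
    Finset.sum_nonneg fun l _ =>
    mul_nonneg (mul_nonneg (hc i) (sq_nonneg _)) (log_gap_nonneg (div_pos (ht0 i) (hσ l)))
  set A := t i • v i - frameOp c t v (v i) with hA
  set B := t j • v j - frameOp c t v (v j) with hB
  have htot : c i / 144 * ‖A‖ ^ 2 + c j / 144 * ‖B‖ ^ 2 ≤
      ∑ i, ∑ l, c i * ⟪v i, e l⟫ ^ 2 * (t i / σ l - 1 - Real.log (t i / σ l)) := by
    classical
    refine (add_le_add (hterm i) (hterm j)).trans ?_
    rw [← Finset.sum_pair (f := fun i => ∑ l, c i * ⟪v i, e l⟫ ^ 2 * (t i / σ l - 1 - Real.log (t i / σ l))) hij]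
    exact Finset.sum_le_sum_of_subset_of_nonneg (Finset.subset_univ _) fun i _ _ => hnn i
  have hcross : ⟪v i, v j⟫ * (t i - t j) = ⟪A, v j⟫ - ⟪v i, B⟫ := by
    have hs := frameOp_symm c t v (v i) (v j)
    simp only [ContinuousLinearMap.coe_coe] at hs
    rw [hA, hB, inner_sub_left, inner_sub_right, hs, inner_smul_left, inner_smul_right]
    simp only [conj_trivial]; ring
  have hA1 : |⟪A, v j⟫| ≤ ‖A‖ := by simpa [hv] using abs_real_inner_le_norm A (v j)
  have hB1 : |⟪v i, B⟫| ≤ ‖B‖ := by simpa [hv] using abs_real_inner_le_norm (v i) B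
  have hsq : ⟪v i, v j⟫ ^ 2 * (t i - t j) ^ 2 ≤ 2 * (‖A‖ ^ 2 + ‖B‖ ^ 2) := by
    rw [← mul_pow, hcross]
    have h1 : ⟪A, v j⟫ ^ 2 ≤ ‖A‖ ^ 2 := by rw [← sq_abs]; gcongr
    have h2 : ⟪v i, B⟫ ^ 2 ≤ ‖B‖ ^ 2 := by rw [← sq_abs]; gcongr
    nlinarith [sq_nonneg (⟪A, v j⟫ + ⟪v i, B⟫)]
  rw [h]
  have hp : 0 ≤ ∏ i, t i ^ c i := Finset.prod_nonneg fun i _ => Real.rpow_nonneg (ht0 i).le _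
  apply mul_le_mul_of_nonneg_left _ hp
  have h7 : δ / 288 * (⟪v i, v j⟫ ^ 2 * (t i - t j) ^ 2) ≤
      ∑ i, ∑ l, c i * ⟪v i, e l⟫ ^ 2 * (t i / σ l - 1 - Real.log (t i / σ l)) := by
    refine le_trans ?_ htot
    have := mul_le_mul_of_nonneg_left hsq (by positivity : 0 ≤ δ / 288)
    nlinarith [mul_le_mul_of_nonneg_right hi (sq_nonneg ‖A‖), mul_le_mul_of_nonneg_right hj (sq_nonneg ‖B‖)]
  linarith [Real.add_one_le_exp (∑ i, ∑ l, c i * ⟪v i, e l⟫ ^ 2 * (t i / σ l - 1 - Real.log (t i / σ l)))]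

end detpart
end

section
section gausspart
variable {V : Type*} [NormedAddCommGroup V] [InnerProductSpace ℝ V] [FiniteDimensional ℝ V]
  [MeasurableSpace V] [BorelSpace V]
  {ι : Type*} [Fintype ι]

/-- Gaussian density -/
def gdens (V : Type*) [NormedAddCommGroup V] [InnerProductSpace ℝ V] (x : V) : ℝ :=
  (2 * Real.pi) ^ (-(Module.finrank ℝ V : ℝ) / 2) * Real.exp (-‖x‖ ^ 2 / 2)

lemma gdens_pos (x : V) : 0 < gdens V x := by unfold gdens; positivity

lemma gdens_cont : Continuous (gdens V) := by unfold gdens; fun_prop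

lemma rexp_integrable {b : ℝ} (hb : 0 < b) : Integrable (fun x : V => Real.exp (-b * ‖x‖ ^ 2)) := by
  by_contra h
  have h1 := GaussianFourier.integral_rexp_neg_mul_sq_norm (V := V) hb
  rw [integral_undef h] at h1
  have : 0 < (Real.pi / b) ^ (Module.finrank ℝ V / 2 : ℝ) := by positivity
  linarith

lemma gdens_integrable : Integrable (gdens V) := by
  unfold gdens
  apply Integrable.const_mul
  convert rexp_integrable (V := V) (b := 1/2) (by norm_num) using 3
  ring

lemma gdens_integral : ∫ x, gdens V x = 1 := by
  unfold gdens
  rw [integral_const_mul]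
  have h1 := GaussianFourier.integral_rexp_neg_mul_sq_norm (V := V) (b := 1/2) (by norm_num)
  have h2 : ∀ x : V, -‖x‖ ^ 2 / 2 = -(1/2) * ‖x‖ ^ 2 := fun x => by ring
  simp_rw [h2]
  rw [h1, neg_div, Real.rpow_neg (by positivity)]
  have : Real.pi / (1/2) = 2 * Real.pi := by ring
  rw [this]
  exact inv_mul_cancel₀ (by positivity)

lemma stdGaussian_eq_withDensity :
    stdGaussian V = volume.withDensity fun x => ENNReal.ofReal (gdens V x) := by
  have hfin : IsFiniteMeasure (volume.withDensity fun x : V => ENNReal.ofReal (gdens V x)) :=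
    isFiniteMeasure_withDensity_ofReal gdens_integrable.2
  apply Measure.ext_of_charFun
  funext t
  rw [charFun_stdGaussian, charFun_apply,
    integral_withDensity_eq_integral_toReal_smul (gdens_cont.measurable.ennreal_ofReal)
      (by simp)]
  have h1 := GaussianFourier.integral_cexp_neg_mul_sq_norm_add (V := V) (b := 1/2) (by norm_num)
    Complex.I t
  have h2 : ∀ x : V, (ENNReal.ofReal (gdens V x)).toReal • Complex.exp (⟪x, t⟫ * Complex.I) =
      ((2 * Real.pi) ^ (-(Module.finrank ℝ V : ℝ) / 2) : ℝ) *
        Complex.exp (-(1/2) * ‖x‖ ^ 2 + Complex.I * ⟪t, x⟫) := by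
    intro x
    rw [ENNReal.toReal_ofReal (gdens_pos x).le, gdens, real_inner_comm, Complex.exp_add]
    simp only [Complex.real_smul, Complex.ofReal_mul, Complex.ofReal_exp]
    push_cast
    rw [mul_assoc]
    congr 3
    · ring_nf
    · ring_nf
  simp_rw [h2]
  rw [integral_const_mul, h1, ← mul_assoc]
  have h3 : (((2 * Real.pi) ^ (-(Module.finrank ℝ V : ℝ) / 2) : ℝ) : ℂ) *
      ((Real.pi : ℂ) / (1/2)) ^ ((Module.finrank ℝ V : ℂ) / 2) = 1 := by
    have : ((Real.pi : ℂ) / (1/2)) = ((2 * Real.pi : ℝ) : ℂ) := by push_cast; ring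
    rw [this]
    have e2 : ((Module.finrank ℝ V : ℂ) / 2) = (((Module.finrank ℝ V : ℝ) / 2 : ℝ) : ℂ) := by
      push_cast; ring
    rw [e2, ← Complex.ofReal_cpow (by positivity), ← Complex.ofReal_mul, neg_div,
      Real.rpow_neg (by positivity), inv_mul_cancel₀ (by positivity)]
    simp
  rw [h3, one_mul]
  congr 1
  rw [Complex.I_sq]; ring

lemma sum_c (c : ι → ℝ) (v : ι → V) (hv : ∀ i, ‖v i‖ = 1)
    (hiso : ∀ x : V, ‖x‖ ^ 2 = ∑ i, c i * ⟪v i, x⟫ ^ 2) : ∑ i, c i = Module.finrank ℝ V := by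
  let e := stdOrthonormalBasis ℝ V
  have h1 : ∑ l, ∑ i, c i * ⟪v i, e l⟫ ^ 2 = Module.finrank ℝ V := by
    have : ∀ l, ∑ i, c i * ⟪v i, e l⟫ ^ 2 = 1 := fun l => by rw [← hiso, e.norm_eq_one]; norm_num
    simp [this]
  rw [← h1, Finset.sum_comm]
  refine Finset.sum_congr rfl fun i _ => ?_
  rw [← Finset.mul_sum, e.sum_sq_inner_left, hv]; norm_num

lemma norm_comb_le (c : ι → ℝ) (v : ι → V) (hc : ∀ i, 0 ≤ c i)
    (hiso : ∀ x : V, ‖x‖ ^ 2 = ∑ i, c i * ⟪v i, x⟫ ^ 2) (θ : ι → ℝ) :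
    ‖∑ i, (c i * θ i) • v i‖ ^ 2 ≤ ∑ i, c i * θ i ^ 2 := by
  set X := ∑ i, (c i * θ i) • v i with hX
  have h1 : ‖X‖ ^ 2 = ∑ i, c i * θ i * ⟪v i, X⟫ := by
    rw [← real_inner_self_eq_norm_sq]
    conv_lhs => rw [hX, sum_inner]
    exact Finset.sum_congr rfl fun i _ => by rw [inner_smul_left]; simp [hX]
  have h2 : ‖X‖ ^ 2 ≤ ∑ i, (c i * θ i ^ 2 / 2 + c i * ⟪v i, X⟫ ^ 2 / 2) := by
    rw [h1]
    refine Finset.sum_le_sum fun i _ => ?_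
    nlinarith [mul_nonneg (hc i) (sq_nonneg (θ i - ⟪v i, X⟫))]
  rw [Finset.sum_add_distrib, ← Finset.sum_div, ← Finset.sum_div, ← hiso] at h2
  linarith

/-- Brascamp and Lieb for half-lines, with a remainder term. -/
lemma brascamp_lieb_rem (c : ι → ℝ) (v : ι → V) (hv : ∀ i, ‖v i‖ = 1)
    (hiso : ∀ x : V, ‖x‖ ^ 2 = ∑ i, c i * ⟪v i, x⟫ ^ 2) (hc : ∀ i, 0 < c i) (l : ℝ)
    (T : ℝ → ℝ) (hT : ∀ s < l, gPhi (T s) = gPhi s / gPhi l)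
    (hT' : ∀ s < l, HasDerivAt T (Real.exp ((T s ^ 2 - s ^ 2) / 2) / gPhi l) s)
    (B : Set V) (hB : MeasurableSet B) (hBA : B ⊆ {x | ∀ i, ⟪v i, x⟫ < l}) {κ : ℝ} (hκ : 0 ≤ κ)
    (hdet : ∀ x ∈ B, (∏ i, (Real.exp ((T ⟪v i, x⟫ ^ 2 - ⟪v i, x⟫ ^ 2) / 2) / gPhi l) ^ c i) * (1 + κ) ≤
      (frameOp c (fun i => Real.exp ((T ⟪v i, x⟫ ^ 2 - ⟪v i, x⟫ ^ 2) / 2) / gPhi l) v).det) :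
    stdGaussian V {x | ∀ i, ⟪v i, x⟫ < l} + ENNReal.ofReal κ * stdGaussian V B ≤
      ENNReal.ofReal (gPhi l ^ Module.finrank ℝ V) := by
  have hl := gPhi_pos l
  set A : Set V := {x | ∀ i, ⟪v i, x⟫ < l} with hA
  set t : V → ι → ℝ := fun x i => Real.exp ((T ⟪v i, x⟫ ^ 2 - ⟪v i, x⟫ ^ 2) / 2) / gPhi l with ht
  set Θ : V → V := fun x => ∑ i, (c i * T ⟪v i, x⟫) • v i with hΘ
  have hAo : IsOpen A := by
    have : A = ⋂ i, {x | ⟪v i, x⟫ < l} := by ext x; simp [hA]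
    rw [this]
    exact isOpen_iInter_of_finite fun i => isOpen_lt (by fun_prop) continuous_const
  have hAm := hAo.measurableSet
  have htpos : ∀ x i, 0 < t x i := fun x i => by simp only [ht]; positivity
  have hder : ∀ x ∈ A, HasFDerivWithinAt Θ (frameOp c (t x) v) A x := by
    intro x hx
    apply HasFDerivAt.hasFDerivWithinAt
    have : HasFDerivAt Θ (∑ i, (c i • (t x i • innerSL ℝ (v i))).smulRight (v i)) x := by
      apply HasFDerivAt.fun_sum
      intro i _
      have h1 : HasFDerivAt (fun x => ⟪v i, x⟫) (innerSL ℝ (v i)) x := (innerSL ℝ (v i)).hasFDerivAt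
      have h2 := (hT' ⟪v i, x⟫ (hx i)).comp_hasFDerivAt x h1
      exact (h2.const_mul (c i)).smul_const (v i)
    convert this using 1
    ext y
    simp [frameOp_apply, mul_assoc]
  have hTmono : ∀ s < l, ∀ s' < l, s < s' → T s < T s' := by
    intro s hs s' hs' h
    apply gPhi_strictMono.lt_iff_lt.1
    rw [hT s hs, hT s' hs']
    exact div_lt_div_of_pos_right (gPhi_strictMono h) hl
  have hinj : InjOn Θ A := by
    intro x hx y hy hxy
    have h0 : ∑ i, c i * ((T ⟪v i, x⟫ - T ⟪v i, y⟫) * (⟪v i, x⟫ - ⟪v i, y⟫)) = 0 := by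
      have : ⟪Θ x - Θ y, x - y⟫ = 0 := by rw [hxy, sub_self, inner_zero_left]
      rw [← this]
      simp only [hΘ, ← Finset.sum_sub_distrib, ← sub_smul, sum_inner, inner_smul_left, inner_sub_right,
        conj_trivial]
      exact Finset.sum_congr rfl fun i _ => by ring
    have hnn : ∀ i, 0 ≤ c i * ((T ⟪v i, x⟫ - T ⟪v i, y⟫) * (⟪v i, x⟫ - ⟪v i, y⟫)) := by
      intro i
      apply mul_nonneg (hc i).le
      rcases lt_trichotomy ⟪v i, x⟫ ⟪v i, y⟫ with h | h | h
      · have := hTmono _ (hx i) _ (hy i) h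
        exact (mul_pos_of_neg_of_neg (by linarith) (by linarith)).le
      · rw [h]; simp
      · have := hTmono _ (hy i) _ (hx i) h
        exact (mul_pos (by linarith) (by linarith)).le
    rw [Finset.sum_eq_zero_iff_of_nonneg fun i _ => hnn i] at h0
    have heq : ∀ i, ⟪v i, x⟫ = ⟪v i, y⟫ := by
      intro i
      have h1 := h0 i (Finset.mem_univ i)
      rcases lt_trichotomy ⟪v i, x⟫ ⟪v i, y⟫ with h | h | h
      · have := hTmono _ (hx i) _ (hy i) h
        exact absurd h1 (mul_pos (hc i) (mul_pos_of_neg_of_neg (by linarith) (by linarith))).ne'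
      · exact h
      · have := hTmono _ (hy i) _ (hx i) h
        exact absurd h1 (mul_pos (hc i) (mul_pos (by linarith) (by linarith))).ne'
    have : ‖x - y‖ ^ 2 = 0 := by
      rw [hiso]
      exact Finset.sum_eq_zero fun i _ => by rw [inner_sub_right, heq]; simp
    exact sub_eq_zero.1 (norm_eq_zero.1 (pow_eq_zero_iff (two_ne_zero) |>.1 this))
  -- pointwise
  have hprod : ∀ x, gPhi l ^ Module.finrank ℝ V * (∏ i, t x i ^ c i) =
      Real.exp ((∑ i, c i * T ⟪v i, x⟫ ^ 2) / 2 - ‖x‖ ^ 2 / 2) := by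
    intro x
    simp only [ht]
    have e1 : ∀ i, (Real.exp ((T ⟪v i, x⟫ ^ 2 - ⟪v i, x⟫ ^ 2) / 2) / gPhi l) ^ c i =
        Real.exp (c i * T ⟪v i, x⟫ ^ 2 / 2 - c i * ⟪v i, x⟫ ^ 2 / 2) / gPhi l ^ c i := by
      intro i
      rw [Real.div_rpow (Real.exp_pos _).le hl.le, ← Real.exp_mul]
      congr 2; ring
    simp_rw [e1, Finset.prod_div_distrib, ← Real.exp_sum, Finset.sum_sub_distrib, ← Finset.sum_div]
    rw [← hiso x, ← Real.rpow_sum_of_pos hl, sum_c c v hv hiso, Real.rpow_natCast]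
    field_simp
  have hpt : ∀ x (d k : ℝ), 0 ≤ k → (∏ i, t x i ^ c i) * (1 + k) ≤ d →
      (1 + k) * gdens V x ≤ gPhi l ^ Module.finrank ℝ V * (|d| * gdens V (Θ x)) := by
    intro x d k hk hd
    have h1 := norm_comb_le c v (fun i => (hc i).le) hiso (fun i => T ⟪v i, x⟫)
    have h2 : (2 * Real.pi) ^ (-(Module.finrank ℝ V : ℝ) / 2) *
        Real.exp (-(∑ i, c i * T ⟪v i, x⟫ ^ 2) / 2) ≤ gdens V (Θ x) := by
      unfold gdens
      gcongr
    calc (1 + k) * gdens V x = (2 * Real.pi) ^ (-(Module.finrank ℝ V : ℝ) / 2) *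
          ((1 + k) * (Real.exp ((∑ i, c i * T ⟪v i, x⟫ ^ 2) / 2 - ‖x‖ ^ 2 / 2) *
          Real.exp (-(∑ i, c i * T ⟪v i, x⟫ ^ 2) / 2))) := by
            unfold gdens; rw [← Real.exp_add]; ring_nf
      _ = gPhi l ^ Module.finrank ℝ V * (((∏ i, t x i ^ c i) * (1 + k)) * 
          ((2 * Real.pi) ^ (-(Module.finrank ℝ V : ℝ) / 2) *
            Real.exp (-(∑ i, c i * T ⟪v i, x⟫ ^ 2) / 2))) := by
            rw [← hprod]; ring
      _ ≤ _ := by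
            apply mul_le_mul_of_nonneg_left _ (by positivity)
            apply mul_le_mul (hd.trans (le_abs_self d)) h2 (by positivity) (abs_nonneg _)
  have hcv := lintegral_image_eq_lintegral_abs_det_fderiv_mul volume hAm hder hinj
    (fun x => ENNReal.ofReal (gdens V x))
  have hle1 : ∫⁻ x in Θ '' A, ENNReal.ofReal (gdens V x) ≤ 1 := by
    have : ∫⁻ x, ENNReal.ofReal (gdens V x) = 1 := by
      rw [← ofReal_integral_eq_lintegral_ofReal gdens_integrable
        (Filter.Eventually.of_forall fun x => (gdens_pos x).le), gdens_integral]
      simp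
    rw [← this]
    exact setLIntegral_le_lintegral _ _
  rw [stdGaussian_eq_withDensity, withDensity_apply _ hAm, withDensity_apply _ hB]
  have hmd : Measurable fun x : V => ENNReal.ofReal (gdens V x) := gdens_cont.measurable.ennreal_ofReal
  calc (∫⁻ x in A, ENNReal.ofReal (gdens V x)) + ENNReal.ofReal κ * ∫⁻ x in B, ENNReal.ofReal (gdens V x)
      = ∫⁻ x in A, (ENNReal.ofReal (gdens V x) + B.indicator (fun x => ENNReal.ofReal κ * ENNReal.ofReal (gdens V x)) x) := by
        rw [lintegral_add_left hmd, lintegral_indicator hB, Measure.restrict_restrict hB,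
          inter_eq_left.2 hBA, lintegral_const_mul _ hmd]
    _ ≤ ∫⁻ x in A, ENNReal.ofReal (gPhi l ^ Module.finrank ℝ V) *
          (ENNReal.ofReal |(frameOp c (t x) v).det| * ENNReal.ofReal (gdens V (Θ x))) := by
        apply setLIntegral_mono' hAm
        intro x hx
        rw [← ENNReal.ofReal_mul (abs_nonneg _), ← ENNReal.ofReal_mul (by positivity)]
        by_cases hxB : x ∈ B
        · rw [indicator_of_mem hxB, ← ENNReal.ofReal_mul hκ, ← ENNReal.ofReal_add (gdens_pos x).le
            (mul_nonneg hκ (gdens_pos x).le)]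
          apply ENNReal.ofReal_le_ofReal
          have := hpt x _ κ hκ (hdet x hxB)
          linarith
        · rw [indicator_of_notMem hxB, add_zero]
          apply ENNReal.ofReal_le_ofReal
          have := hpt x _ 0 le_rfl ((by simpa using frameOp_det_ge c (t x) v hv hiso (fun i => (hc i).le) (htpos x)))
          linarith
    _ = ENNReal.ofReal (gPhi l ^ Module.finrank ℝ V) * ∫⁻ x in Θ '' A, ENNReal.ofReal (gdens V x) := by
        rw [lintegral_const_mul' _ _ ENNReal.ofReal_ne_top, hcv]
    _ ≤ ENNReal.ofReal (gPhi l ^ Module.finrank ℝ V) * 1 := by gcongr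
    _ = _ := mul_one _

end gausspart
end

section
lemma layer_compare {Ω : Type*} [MeasurableSpace Ω] (μ : Measure Ω) [IsProbabilityMeasure μ]
    (F F0 : Ω → ℝ) (hF : Measurable F) (hF0 : Measurable F0) (hFi : Integrable F μ)
    (hF0i : Integrable F0 μ) {d : ℝ} (hd : 0 ≤ d)
    (h1 : ∀ t, μ {x | F x < t} ≤ μ {x | F0 x < t})
    (h2 : ∀ t, 1 / 2 ≤ t → t ≤ 1 → μ {x | F x < t} + ENNReal.ofReal d ≤ μ {x | F0 x < t}) :
    (∫ x, F0 x ∂μ) + d / 2 ≤ ∫ x, F x ∂μ := by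
  have hpos : ∀ G : Ω → ℝ, Measurable G → ∫⁻ x, ENNReal.ofReal (G x) ∂μ =
      ∫⁻ t in Ioi (0:ℝ), μ {x | t ≤ G x} := by
    intro G hG
    have e1 : ∀ x, ENNReal.ofReal (G x) = ENNReal.ofReal (max (G x) 0) := fun x => by simp
    simp_rw [e1]
    rw [lintegral_eq_lintegral_meas_le μ (f := fun x => max (G x) 0) (Filter.Eventually.of_forall fun x => le_max_right _ _)
      (hG.max measurable_const).aemeasurable]
    apply setLIntegral_congr_fun measurableSet_Ioi
    intro t ht
    change μ {x | t ≤ max (G x) 0} = μ {x | t ≤ G x}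
    congr 1
    ext x
    have : (0:ℝ) < t := ht
    simp only [Set.mem_ofPred_eq, le_max_iff]
    constructor
    · rintro (h | h)
      · exact h
      · linarith
    · exact Or.inl
  have hneg : ∀ G : Ω → ℝ, Measurable G → ∫⁻ x, ENNReal.ofReal (- G x) ∂μ =
      ∫⁻ t in Ioi (0:ℝ), μ {x | G x < - t} := by
    intro G hG
    have e1 : ∀ x, ENNReal.ofReal (- G x) = ENNReal.ofReal (max (- G x) 0) := fun x => by simp
    simp_rw [e1]
    rw [lintegral_eq_lintegral_meas_lt μ (f := fun x => max (- G x) 0) (Filter.Eventually.of_forall fun x => le_max_right _ _)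
      (hG.neg.max measurable_const).aemeasurable]
    apply setLIntegral_congr_fun measurableSet_Ioi
    intro t ht
    change μ {x | t < max (- G x) 0} = μ {x | G x < - t}
    congr 1
    ext x
    have : (0:ℝ) < t := ht
    simp only [Set.mem_ofPred_eq, lt_max_iff]
    constructor
    · rintro (h | h)
      · linarith
      · linarith
    · intro h; left; linarith
  have hcompl : ∀ G : Ω → ℝ, Measurable G → ∀ t, μ {x | t ≤ G x} + μ {x | G x < t} = 1 := by
    intro G hG t
    have : {x | G x < t} = {x | t ≤ G x}ᶜ := by ext x; simp
    rw [this, measure_add_measure_compl (measurableSet_le measurable_const hG), measure_univ]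
  have hmono : ∀ t (e : ℝ≥0∞), μ {x | F x < t} + e ≤ μ {x | F0 x < t} →
      μ {x | t ≤ F0 x} + e ≤ μ {x | t ≤ F x} := by
    intro t e h
    have a1 := hcompl F hF t
    have a2 := hcompl F0 hF0 t
    have : μ {x | t ≤ F0 x} + e + μ {x | F x < t} ≤ μ {x | t ≤ F x} + μ {x | F x < t} := by
      rw [a1, ← a2, add_assoc, add_comm e]
      gcongr
    exact (ENNReal.add_le_add_iff_right (measure_ne_top μ _)).1 this
  have hP : ∫⁻ x, ENNReal.ofReal (F0 x) ∂μ + ENNReal.ofReal (d / 2) ≤ ∫⁻ x, ENNReal.ofReal (F x) ∂μ := by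
    rw [hpos F hF, hpos F0 hF0]
    have e1 : ENNReal.ofReal (d / 2) = ∫⁻ t in Ioi (0:ℝ), (Icc (1/2:ℝ) 1).indicator (fun _ => ENNReal.ofReal d) t := by
      have hsub : Icc (1/2:ℝ) 1 ⊆ Ioi 0 := fun t ht => lt_of_lt_of_le (by norm_num) ht.1
      rw [lintegral_indicator measurableSet_Icc, Measure.restrict_restrict measurableSet_Icc,
        inter_eq_left.2 hsub, setLIntegral_const,
        Real.volume_Icc, ← ENNReal.ofReal_mul hd]
      congr 1; ring
    rw [e1, ← lintegral_add_right _ (measurable_const.indicator measurableSet_Icc)]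
    apply lintegral_mono
    intro t
    by_cases ht : t ∈ Icc (1/2:ℝ) 1
    · simp only [indicator_of_mem ht]
      exact hmono t _ (h2 t ht.1 ht.2)
    · simp only [indicator_of_notMem ht]
      exact hmono t 0 (by simpa using h1 t)
  have hN : ∫⁻ x, ENNReal.ofReal (- F x) ∂μ ≤ ∫⁻ x, ENNReal.ofReal (- F0 x) ∂μ := by
    rw [hneg F hF, hneg F0 hF0]
    exact lintegral_mono fun t => h1 (-t)
  have fin1 : ∀ G : Ω → ℝ, Integrable G μ → ∫⁻ x, ENNReal.ofReal (G x) ∂μ ≠ ∞ := fun G hG => by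
    have := hG.lintegral_lt_top
    exact this.ne
  rw [integral_eq_lintegral_pos_part_sub_lintegral_neg_part hFi,
    integral_eq_lintegral_pos_part_sub_lintegral_neg_part hF0i]
  have hN' := ENNReal.toReal_mono (fin1 _ hF0i.neg) hN
  have hP' := ENNReal.toReal_mono (fin1 _ hFi) hP
  rw [ENNReal.toReal_add (fin1 _ hF0i) ENNReal.ofReal_ne_top, ENNReal.toReal_ofReal (by positivity)] at hP'
  simp only [Pi.neg_apply] at hN'
  linarith

section ballpart
variable {V : Type*} [NormedAddCommGroup V] [InnerProductSpace ℝ V] [FiniteDimensional ℝ V]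
  [MeasurableSpace V] [BorelSpace V]
  {ι : Type*} [Fintype ι]

open scoped Pointwise in
lemma volume_closedBall_ge (hm : 1 ≤ Module.finrank ℝ V) (p : V) {ρ : ℝ} (hρ : 0 ≤ ρ) :
    ENNReal.ofReal ((ρ / Module.finrank ℝ V) ^ Module.finrank ℝ V) ≤ volume (closedBall p ρ) := by
  set m := Module.finrank ℝ V with hmdef
  have hm0 : (0:ℝ) < m := by exact_mod_cast hm
  let e := stdOrthonormalBasis ℝ V
  have h1 := e.volume_parallelepiped
  have h2 : volume ((ρ / m) • parallelepiped e) = ENNReal.ofReal ((ρ / m) ^ m) := by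
    rw [Measure.addHaar_smul, h1, mul_one, abs_of_nonneg (by positivity)]
  have h3 : (ρ / m) • parallelepiped e ⊆ closedBall 0 ρ := by
    rintro _ ⟨x, hx, rfl⟩
    rw [mem_parallelepiped_iff] at hx
    obtain ⟨t, ht, rfl⟩ := hx
    rw [mem_closedBall_zero_iff]
    simp only
    rw [norm_smul, Real.norm_of_nonneg (by positivity)]
    have : ‖∑ i, t i • e i‖ ≤ m := by
      refine (norm_sum_le _ _).trans ?_
      have : ∀ i, ‖t i • e i‖ ≤ 1 := fun i => by
        rw [norm_smul, e.norm_eq_one, mul_one, Real.norm_of_nonneg (ht.1 i)]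
        exact ht.2 i
      refine (Finset.sum_le_sum fun i _ => this i).trans ?_
      simp [hmdef]
    calc ρ / m * ‖∑ i, t i • e i‖ ≤ ρ / m * m := by gcongr
      _ = ρ := by field_simp
  calc _ = volume ((ρ / m) • parallelepiped e) := h2.symm
    _ ≤ volume (closedBall (0:V) ρ) := measure_mono h3
    _ = _ := by rw [Measure.addHaar_closedBall_center, ← Measure.addHaar_closedBall_center volume p]

lemma gauss_closedBall_ge (hm : 1 ≤ Module.finrank ℝ V) (p : V) {ρ : ℝ} (hρ : 0 ≤ ρ)
    (hp : ‖p‖ + ρ ≤ 1) :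
    ENNReal.ofReal ((ρ / (6 * Module.finrank ℝ V)) ^ Module.finrank ℝ V) ≤
      stdGaussian V (closedBall p ρ) := by
  set m := Module.finrank ℝ V with hmdef
  have hm0 : (0:ℝ) < m := by exact_mod_cast hm
  rw [stdGaussian_eq_withDensity, withDensity_apply _ measurableSet_closedBall]
  have hd : ∀ x ∈ closedBall p ρ, (1/6:ℝ)^m ≤ gdens V x := by
    intro x hx
    have hx1 : ‖x‖ ≤ 1 := by
      have : ‖x - p‖ ≤ ρ := by rwa [← dist_eq_norm]
      have := norm_le_norm_add_norm_sub' x p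
      linarith
    have hs : (2 * Real.pi) ^ (-(m : ℝ) / 2) = ((√(2 * Real.pi))⁻¹) ^ m := by
      rw [Real.sqrt_eq_rpow, ← Real.rpow_neg (by positivity), ← Real.rpow_natCast, ← Real.rpow_mul (by positivity)]
      congr 1; ring
    unfold gdens
    rw [← hmdef, hs]
    have a1 : (1/3:ℝ) ≤ (√(2 * Real.pi))⁻¹ := by
      rw [le_inv_comm₀ (by norm_num) (by positivity), Real.sqrt_le_left (by norm_num)]
      nlinarith [Real.pi_lt_d2]
    have a2 : (1/2:ℝ) ≤ Real.exp (-‖x‖ ^ 2 / 2) := by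
      have := Real.add_one_le_exp (-‖x‖ ^ 2 / 2)
      nlinarith [norm_nonneg x]
    have a3 : (1/2:ℝ)^m ≤ 1/2 := by
      calc (1/2:ℝ)^m ≤ (1/2)^1 := pow_le_pow_of_le_one (by norm_num) (by norm_num) hm
        _ = 1/2 := by norm_num
    calc (1/6:ℝ)^m = (1/3)^m * (1/2)^m := by rw [← mul_pow]; norm_num
      _ ≤ (√(2 * Real.pi))⁻¹ ^ m * Real.exp (-‖x‖ ^ 2 / 2) := by
        gcongr
        linarith
  calc ENNReal.ofReal ((ρ / (6 * m)) ^ m) = ENNReal.ofReal ((1/6:ℝ)^m) * ENNReal.ofReal ((ρ / m)^m) := by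
        rw [← ENNReal.ofReal_mul (by positivity), ← mul_pow]; congr 2; field_simp
    _ ≤ ENNReal.ofReal ((1/6:ℝ)^m) * volume (closedBall p ρ) := by
        gcongr; exact volume_closedBall_ge hm p hρ
    _ = ∫⁻ x in closedBall p ρ, ENNReal.ofReal ((1/6:ℝ)^m) := by rw [setLIntegral_const]
    _ ≤ _ := setLIntegral_mono' measurableSet_closedBall fun x hx => ENNReal.ofReal_le_ofReal (hd x hx)

lemma bl_plain (c : ι → ℝ) (v : ι → V) (hv : ∀ i, ‖v i‖ = 1)
    (hiso : ∀ x : V, ‖x‖ ^ 2 = ∑ i, c i * ⟪v i, x⟫ ^ 2) (hc : ∀ i, 0 < c i) (l : ℝ) :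
    stdGaussian V {x | ∀ i, ⟪v i, x⟫ < l} ≤ ENNReal.ofReal (gPhi l ^ Module.finrank ℝ V) := by
  obtain ⟨T, hT, hT'⟩ := exists_transport l
  have := brascamp_lieb_rem c v hv hiso hc l T hT hT' ∅ MeasurableSet.empty (empty_subset _)
    le_rfl (by simp)
  simpa using this

lemma bl_deficit (hm : 1 ≤ Module.finrank ℝ V) (c : ι → ℝ) (v : ι → V) (hv : ∀ i, ‖v i‖ = 1)
    (hiso : ∀ x : V, ‖x‖ ^ 2 = ∑ i, c i * ⟪v i, x⟫ ^ 2) (hc : ∀ i, 0 < c i) {l : ℝ}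
    (hl1 : 1 / 2 ≤ l) (hl2 : l ≤ 1) {δ : ℝ} (hδ : 0 ≤ δ) {i j : ι} (hij : v i ≠ v j)
    (hi : δ ≤ c i) (hj : δ ≤ c j) :
    stdGaussian V {x | ∀ i, ⟪v i, x⟫ < l} + ENNReal.ofReal
      (δ / 288 * (⟪v i, v j⟫ ^ 2 * (1 / 10000 * ‖v i - v j‖) ^ 2) *
        (1 / (2400 * Module.finrank ℝ V)) ^ Module.finrank ℝ V) ≤
      ENNReal.ofReal (gPhi l ^ Module.finrank ℝ V) := by
  obtain ⟨T, hT, hT'⟩ := exists_transport l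
  have hD : 0 < ‖v i - v j‖ := norm_pos_iff.2 (sub_ne_zero.2 hij)
  set D := ‖v i - v j‖ with hDdef
  set e : V := D⁻¹ • (v i - v j) with he
  have hen : ‖e‖ = 1 := by
    rw [he, norm_smul, norm_inv, Real.norm_of_nonneg hD.le, ← hDdef, inv_mul_cancel₀ hD.ne']
  set p : V := (1/200 : ℝ) • e with hp
  have hpn : ‖p‖ = 1/200 := by rw [hp, norm_smul, hen]; norm_num
  set κ := δ / 288 * (⟪v i, v j⟫ ^ 2 * (1 / 10000 * D) ^ 2) with hκ
  have hκ0 : 0 ≤ κ := by positivity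
  have hnx : ∀ x ∈ closedBall p (1/400), ∀ i, |⟪v i, x⟫| ≤ 1/100 := by
    intro x hx i
    have h1 : ‖x - p‖ ≤ 1/400 := by rwa [← dist_eq_norm]
    have h2 := norm_le_norm_add_norm_sub' x p
    have h3 := abs_real_inner_le_norm (v i) x
    rw [hv, one_mul] at h3
    linarith
  have key := brascamp_lieb_rem c v hv hiso hc l T hT hT' (closedBall p (1/400)) measurableSet_closedBall
    (fun x hx i => by
      have := (abs_le.1 (hnx x hx i)).2
      linarith) hκ0 (fun x hx => by
      have hb := fun i => transport_bounds hl1 hl2 hT (hnx x hx i)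
      refine le_trans ?_ (frameOp_det_stab c _ v hv hiso (fun i => (hc i).le) (fun i => (hb i).2.1)
        (fun i => (hb i).2.2) hδ (fun h => hij (by rw [h])) hi hj)
      apply mul_le_mul_of_nonneg_left _ (Finset.prod_nonneg fun i _ => Real.rpow_nonneg (by linarith [(hb i).2.1]) _)
      have hsep := transport_sep hl1 hl2 hT hT' (hnx x hx i) (hnx x hx j)
      have hs : D * (1/400) ≤ |⟪v i, x⟫ - ⟪v j, x⟫| := by
        have h1 : ‖x - p‖ ≤ 1/400 := by rwa [← dist_eq_norm]
        have h2 : ⟪v i, x⟫ - ⟪v j, x⟫ = D * ⟪e, x⟫ := by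
          rw [he, inner_smul_left, inner_sub_left]; simp; field_simp
        have h3 := abs_real_inner_le_norm e (x - p)
        rw [hen, one_mul, inner_sub_right] at h3
        have h4 : ⟪e, p⟫ = 1/200 := by
          rw [hp, inner_smul_right, real_inner_self_eq_norm_sq, hen]; norm_num
        have h5 : 1/400 ≤ ⟪e, x⟫ := by
          have := (abs_le.1 h3).1
          linarith
        rw [h2]
        refine le_trans ?_ (le_abs_self _)
        gcongr
      have hfin : (1 / 10000 * D) ≤ |Real.exp ((T ⟪v i, x⟫ ^ 2 - ⟪v i, x⟫ ^ 2) / 2) / gPhi l -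
          Real.exp ((T ⟪v j, x⟫ ^ 2 - ⟪v j, x⟫ ^ 2) / 2) / gPhi l| := by linarith
      have hsq : (1 / 10000 * D)^2 ≤ (Real.exp ((T ⟪v i, x⟫ ^ 2 - ⟪v i, x⟫ ^ 2) / 2) / gPhi l -
          Real.exp ((T ⟪v j, x⟫ ^ 2 - ⟪v j, x⟫ ^ 2) / 2) / gPhi l)^2 := by
        rw [← sq_abs (_ - _)]
        gcongr
      rw [hκ]
      gcongr)
  refine le_trans ?_ key
  gcongr
  rw [ENNReal.ofReal_mul hκ0]
  gcongr
  have hb := gauss_closedBall_ge hm p (ρ := 1/400) (by norm_num) (by rw [hpn]; norm_num)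
  refine le_trans (le_of_eq ?_) hb
  congr 2
  have : (Module.finrank ℝ V : ℝ) ≠ 0 := by
    have : Module.finrank ℝ V ≠ 0 := by omega
    exact_mod_cast this
  field_simp; norm_num

lemma gauss_orthonormal (b : OrthonormalBasis ι ℝ V) (l : ℝ) :
    stdGaussian V {x | ∀ i, ⟪b i, x⟫ < l} = ENNReal.ofReal (gPhi l ^ Fintype.card ι) := by
  have hmeas : MeasurableSet {x : V | ∀ i, ⟪b i, x⟫ < l} := by
    have : {x : V | ∀ i, ⟪b i, x⟫ < l} = ⋂ i, {x | ⟪b i, x⟫ < l} := by ext x; simp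
    rw [this]
    exact (isOpen_iInter_of_finite fun i => isOpen_lt (by fun_prop) continuous_const).measurableSet
  rw [stdGaussian_eq_map_pi_orthonormalBasis b, Measure.map_apply (by fun_prop) hmeas]
  have : (fun x : ι → ℝ => ∑ i, x i • b i) ⁻¹' {x : V | ∀ i, ⟪b i, x⟫ < l} =
      Set.pi univ fun _ => Iio l := by
    ext x
    simp only [mem_preimage, Set.mem_ofPred_eq, mem_univ_pi, mem_Iio]
    refine forall_congr' fun i => ?_
    rw [b.orthonormal.inner_right_fintype]
  rw [this, Measure.pi_pi]
  have hIio : gaussianReal 0 1 (Iio l) = ENNReal.ofReal (gPhi l) := by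
    rw [← gPhi_meas]
    have : NullSingletonClass (gaussianReal 0 1) := nullSingletonClass_gaussianReal one_ne_zero
    exact measure_congr Iio_ae_eq_Iic
  simp [hIio, ENNReal.ofReal_pow (gPhi_pos l).le]

end ballpart
end

section
section gaugepart
variable {ι : Type*} [Fintype ι] [Nonempty ι]

def hmax {V : Type*} [NormedAddCommGroup V] [InnerProductSpace ℝ V] (u : ι → V) (x : V) : ℝ :=
  Finset.univ.sup' Finset.univ_nonempty fun i => ⟪u i, x⟫

lemma hmax_le_iff {V : Type*} [NormedAddCommGroup V] [InnerProductSpace ℝ V] (u : ι → V) (x : V)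
    (r : ℝ) : hmax u x ≤ r ↔ ∀ i, ⟪u i, x⟫ ≤ r := by
  simp [hmax, Finset.sup'_le_iff]

lemma hmax_lt_iff {V : Type*} [NormedAddCommGroup V] [InnerProductSpace ℝ V] (u : ι → V) (x : V)
    (r : ℝ) : hmax u x < r ↔ ∀ i, ⟪u i, x⟫ < r := by
  simp [hmax, Finset.sup'_lt_iff]

lemma hmax_cont {V : Type*} [NormedAddCommGroup V] [InnerProductSpace ℝ V] (u : ι → V) :
    Continuous (hmax u) :=
  Continuous.finset_sup'_apply _ fun i _ => by fun_prop

lemma hmax_abs_le {V : Type*} [NormedAddCommGroup V] [InnerProductSpace ℝ V] (u : ι → V)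
    (hu : ∀ i, ‖u i‖ = 1) (x : V) : |hmax u x| ≤ ‖x‖ := by
  have h : ∀ i, |⟪u i, x⟫| ≤ ‖x‖ := fun i => by
    have := abs_real_inner_le_norm (u i) x
    rwa [hu, one_mul] at this
  rw [abs_le]
  constructor
  · obtain ⟨i⟩ := ‹Nonempty ι›
    exact (abs_le.1 (h i)).1.trans ((hmax_le_iff u x _).1 le_rfl i)
  · exact (hmax_le_iff u x _).2 fun i => (abs_le.1 (h i)).2

lemma hmax_integrable {V : Type*} [NormedAddCommGroup V] [InnerProductSpace ℝ V]
    [FiniteDimensional ℝ V] [MeasurableSpace V] [BorelSpace V] (u : ι → V)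
    (hu : ∀ i, ‖u i‖ = 1) : Integrable (hmax u) (stdGaussian V) := by
  have h : Integrable (id : V → V) (stdGaussian V) := IsGaussian.integrable_id
  exact h.norm.mono' (hmax_cont u).aestronglyMeasurable
    (Filter.Eventually.of_forall fun x => by simpa using hmax_abs_le u hu x)

lemma gauge_polar_eq {n : ℕ} (u : ι → EuclideanSpace ℝ (Fin n)) (c : ι → ℝ) (hc : ∀ i, 0 < c i)
    (hcent : ∑ i, c i • u i = 0) (x : EuclideanSpace ℝ (Fin n)) :
    gauge (polarSet (convexHull ℝ (Set.range u))) x = hmax u x := by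
  have hM0 : 0 ≤ hmax u x := by
    by_contra hlt
    have := (hmax_lt_iff u x 0).1 (not_le.1 hlt)
    have h0 : ∑ i, c i * ⟪u i, x⟫ = 0 := by
      have : ⟪∑ i, c i • u i, x⟫ = 0 := by rw [hcent, inner_zero_left]
      rw [sum_inner] at this
      simpa [inner_smul_left] using this
    have : ∑ i, c i * ⟪u i, x⟫ < 0 :=
      Finset.sum_neg (fun i _ => mul_neg_of_pos_of_neg (hc i) (this i)) Finset.univ_nonempty
    linarith
  have hmem : ∀ y : EuclideanSpace ℝ (Fin n),
      y ∈ polarSet (convexHull ℝ (Set.range u)) ↔ ∀ i, ⟪u i, y⟫ ≤ 1 := by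
    intro y
    constructor
    · intro h i
      rw [real_inner_comm]
      exact h _ (subset_convexHull ℝ _ ⟨i, rfl⟩)
    · intro h z hz
      have hconv : Convex ℝ {z : EuclideanSpace ℝ (Fin n) | ⟪y, z⟫ ≤ 1} :=
        convex_halfSpace_le (f := fun z => ⟪y, z⟫) ⟨fun a b => inner_add_right _ _ _, fun a b => by
          simp [inner_smul_right]⟩ 1
      have hsub : Set.range u ⊆ {z : EuclideanSpace ℝ (Fin n) | ⟪y, z⟫ ≤ 1} := by
        rintro _ ⟨i, rfl⟩
        have := h i
        rw [real_inner_comm] at this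
        exact this
      exact convexHull_min hsub hconv hz
  have hset : {r : ℝ | r ∈ Set.Ioi (0:ℝ) ∧ r⁻¹ • x ∈ polarSet (convexHull ℝ (Set.range u))} =
      {r : ℝ | 0 < r ∧ hmax u x ≤ r} := by
    ext r
    constructor
    · rintro ⟨hr, h⟩
      have hr' : (0:ℝ) < r := hr
      refine ⟨hr, (hmax_le_iff u x r).2 fun i => ?_⟩
      have := (hmem _).1 h i
      rw [inner_smul_right, inv_mul_le_iff₀ hr'] at this
      linarith
    · rintro ⟨hr, h⟩
      refine ⟨hr, (hmem _).2 fun i => ?_⟩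
      rw [inner_smul_right, inv_mul_le_iff₀ hr]
      have := (hmax_le_iff u x r).1 h i
      linarith
  rw [gauge_def', hset]
  apply le_antisymm
  · apply le_of_forall_pos_le_add
    intro e he
    exact csInf_le ⟨0, fun r hr => hr.1.le⟩ ⟨by linarith, by linarith⟩
  · exact le_csInf ⟨hmax u x + 1, by linarith, by linarith⟩ fun r hr => hr.2

lemma ellNorm_eq {n : ℕ} (u : ι → EuclideanSpace ℝ (Fin n)) (c : ι → ℝ) (hc : ∀ i, 0 < c i)
    (hcent : ∑ i, c i • u i = 0) :
    ellNorm n (polarSet (convexHull ℝ (Set.range u))) =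
      ∫ x, hmax u x ∂(stdGaussian (EuclideanSpace ℝ (Fin n))) := by
  have : gaussianM n = stdGaussian (EuclideanSpace ℝ (Fin n)) := by
    rw [stdGaussian_eq_withDensity]
    simp [gaussianM, gdens]
  rw [ellNorm, this]
  exact integral_congr_ae (Filter.Eventually.of_forall fun x => gauge_polar_eq u c hc hcent x)

end gaugepart

abbrev VV (n : ℕ) := WithLp 2 (EuclideanSpace ℝ (Fin n) × ℝ)

lemma finrank_VV (n : ℕ) : Module.finrank ℝ (VV n) = n + 1 := by
  rw [LinearEquiv.finrank_eq (WithLp.linearEquiv 2 ℝ _)]; simp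

def liftV {n : ℕ} (x : EuclideanSpace ℝ (Fin n)) : VV n :=
  √((n:ℝ) / (n + 1)) • WithLp.toLp 2 (x, 1 / √(n:ℝ))

lemma liftV_inner_right {n : ℕ} (x : EuclideanSpace ℝ (Fin n)) (Y : VV n) :
    ⟪liftV x, Y⟫ = √((n:ℝ) / (n + 1)) * (⟪x, Y.fst⟫ + 1 / √(n:ℝ) * Y.snd) := by
  rw [liftV, inner_smul_left, WithLp.prod_inner_apply]
  simp
  left; ring

lemma liftV_inner {n : ℕ} (hn : 1 ≤ n) (x y : EuclideanSpace ℝ (Fin n)) :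
    ⟪liftV x, liftV y⟫ = (n:ℝ) / (n + 1) * (⟪x, y⟫ + 1 / n) := by
  have hn' : (0:ℝ) < n := by exact_mod_cast hn
  have h1 : √((n:ℝ) / (n + 1)) * √((n:ℝ) / (n + 1)) = (n:ℝ) / (n + 1) := Real.mul_self_sqrt (by positivity)
  have h2 : (√(n:ℝ))⁻¹ * (√(n:ℝ))⁻¹ = (n:ℝ)⁻¹ := by rw [← mul_inv, Real.mul_self_sqrt hn'.le]
  rw [liftV_inner_right]
  simp only [liftV, WithLp.smul_fst, WithLp.smul_snd, WithLp.toLp_fst, WithLp.toLp_snd, inner_smul_right, smul_eq_mul, one_div]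
  linear_combination (⟪x, y⟫ + (√(n:ℝ))⁻¹ * (√(n:ℝ))⁻¹) * h1 + (n:ℝ) / (n + 1) * h2

lemma liftV_norm {n : ℕ} (hn : 1 ≤ n) (x : EuclideanSpace ℝ (Fin n)) (hx : ‖x‖ = 1) :
    ‖liftV x‖ = 1 := by
  have hn' : (0:ℝ) < n := by exact_mod_cast hn
  have := liftV_inner hn x x
  rw [real_inner_self_eq_norm_sq, real_inner_self_eq_norm_sq, hx] at this
  have h2 : ‖liftV x‖ ^ 2 = 1 := by rw [this]; field_simp
  nlinarith [norm_nonneg (liftV x)]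

lemma map_fst_stdGaussian (n : ℕ) :
    (stdGaussian (VV n)).map (WithLp.fstL 2 ℝ (EuclideanSpace ℝ (Fin n)) ℝ) =
      stdGaussian (EuclideanSpace ℝ (Fin n)) := by
  have : IsProbabilityMeasure ((stdGaussian (VV n)).map (WithLp.fstL 2 ℝ (EuclideanSpace ℝ (Fin n)) ℝ)) :=
    Measure.isProbabilityMeasure_map (by fun_prop)
  apply Measure.ext_of_charFun
  ext t
  rw [charFun_stdGaussian]
  have h2 := charFun_stdGaussian (E := VV n) (WithLp.toLp 2 (t, 0))
  rw [charFun_apply] at h2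
  rw [charFun_apply, integral_map (by fun_prop) (by fun_prop)]
  have hnorm : ‖(WithLp.toLp 2 (t, 0) : VV n)‖ = ‖t‖ := by
    simp
  rw [hnorm] at h2
  rw [← h2]
  congr 1
  ext Y
  congr 2
  rw [WithLp.prod_inner_apply]
  simp

section bridge
variable {ι : Type*} [Fintype ι] [Nonempty ι]

lemma hmax_lift {n : ℕ} (u : ι → EuclideanSpace ℝ (Fin n)) (Y : VV n) :
    hmax (fun i => liftV (u i)) Y =
      √((n:ℝ) / (n + 1)) * (hmax u Y.fst + 1 / √(n:ℝ) * Y.snd) := by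
  have hs : 0 ≤ √((n:ℝ) / (n + 1)) := Real.sqrt_nonneg _
  apply le_antisymm
  · rw [hmax_le_iff]
    intro i
    rw [liftV_inner_right]
    have := (hmax_le_iff u Y.fst _).1 le_rfl i
    gcongr
  · obtain ⟨i, -, hi⟩ := Finset.exists_mem_eq_sup' (Finset.univ_nonempty (α := ι)) (fun i => ⟪u i, Y.fst⟫)
    have : hmax u Y.fst = ⟪u i, Y.fst⟫ := hi
    rw [this, ← liftV_inner_right]
    exact (hmax_le_iff (fun i => liftV (u i)) Y _).1 le_rfl i

lemma integral_hmax_lift {n : ℕ} (u : ι → EuclideanSpace ℝ (Fin n)) (hu : ∀ i, ‖u i‖ = 1) :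
    ∫ Y, hmax (fun i => liftV (u i)) Y ∂(stdGaussian (VV n)) =
      √((n:ℝ) / (n + 1)) * ∫ x, hmax u x ∂(stdGaussian (EuclideanSpace ℝ (Fin n))) := by
  simp_rw [hmax_lift]
  rw [integral_const_mul]
  congr 1
  have hi := hmax_integrable u hu
  rw [← map_fst_stdGaussian] at hi ⊢
  rw [integral_map (by fun_prop) (hmax_cont u).aestronglyMeasurable]
  have hi' := hi.comp_measurable (by fun_prop)
  have hL : Integrable (WithLp.sndL 2 ℝ (EuclideanSpace ℝ (Fin n)) ℝ) (stdGaussian (VV n)) :=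
    IsGaussian.integrable_dual _ _
  have h0 := integral_strongDual_stdGaussian (WithLp.sndL 2 ℝ (EuclideanSpace ℝ (Fin n)) ℝ)
  have := integral_add hi' (hL.const_mul (1 / √(n:ℝ)))
  rw [integral_const_mul, h0, mul_zero, add_zero] at this
  exact this

end bridge

lemma lift_iso {n : ℕ} (hn : 1 ≤ n) {ι : Type*} [Fintype ι] (u : ι → EuclideanSpace ℝ (Fin n))
    (hu : ∀ i, ‖u i‖ = 1) (c : ι → ℝ)
    (hiso : ∀ x : EuclideanSpace ℝ (Fin n), ‖x‖ ^ 2 = ∑ i, c i * ⟪u i, x⟫ ^ 2)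
    (hcent : ∑ i, c i • u i = 0) (Y : VV n) :
    ‖Y‖ ^ 2 = ∑ i, ((n + 1 : ℝ) / n * c i) * ⟪liftV (u i), Y⟫ ^ 2 := by
  have hn' : (0:ℝ) < n := by exact_mod_cast hn
  have hsum : ∑ i, c i = n := by
    have := sum_c c u hu hiso
    simpa using this
  have h0 : ∑ i, c i * ⟪u i, Y.fst⟫ = 0 := by
    have : ⟪∑ i, c i • u i, Y.fst⟫ = 0 := by rw [hcent, inner_zero_left]
    rw [sum_inner] at this
    simpa [inner_smul_left] using this
  have hs : √((n:ℝ) / (n + 1)) ^ 2 = (n:ℝ) / (n + 1) := Real.sq_sqrt (by positivity)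
  have hs2 : (1 / √(n:ℝ)) ^ 2 = 1 / n := by rw [div_pow, Real.sq_sqrt hn'.le, one_pow]
  have hterm : ∀ i, ((n + 1 : ℝ) / n * c i) * ⟪liftV (u i), Y⟫ ^ 2 =
      c i * ⟪u i, Y.fst⟫ ^ 2 + (2 * (1 / √(n:ℝ)) * Y.snd) * (c i * ⟪u i, Y.fst⟫) + (1 / n * Y.snd ^ 2) * c i := by
    intro i
    rw [liftV_inner_right, mul_pow, hs, ← hs2]
    field_simp
    ring
  simp_rw [hterm]
  rw [Finset.sum_add_distrib, Finset.sum_add_distrib, ← Finset.mul_sum, ← Finset.mul_sum, h0, hsum,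
    ← hiso, ← real_inner_self_eq_norm_sq, WithLp.prod_inner_apply]
  have : ⟪Y.ofLp.2, Y.ofLp.2⟫ = Y.snd ^ 2 := by simp [sq]
  rw [this, real_inner_self_eq_norm_sq]
  simp only [mul_zero, add_zero]
  field_simp
  rfl

lemma regVerts_sum {n : ℕ} (hn : 1 ≤ n) (w : Fin (n + 1) → EuclideanSpace ℝ (Fin n))
    (hw : IsRegVerts w) : ∑ i, w i = 0 := by
  have hn' : (0:ℝ) < n := by exact_mod_cast hn
  have h : ∀ i, ⟪w i, ∑ j, w j⟫ = 0 := by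
    intro i
    rw [inner_sum, ← Finset.add_sum_erase _ _ (Finset.mem_univ i)]
    rw [Finset.sum_congr rfl (fun j hj => hw.2 i j (Finset.ne_of_mem_erase hj).symm)]
    rw [real_inner_self_eq_norm_sq, hw.1]
    simp [Finset.card_erase_of_mem]
    field_simp
    norm_num
  have : ⟪∑ i, w i, ∑ j, w j⟫ = 0 := by
    rw [sum_inner]; exact Finset.sum_eq_zero fun i _ => h i
  exact inner_self_eq_zero.1 this

lemma regVerts_basis {n : ℕ} (hn : 1 ≤ n) (w : Fin (n + 1) → EuclideanSpace ℝ (Fin n))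
    (hw : IsRegVerts w) : ∃ b : OrthonormalBasis (Fin (n + 1)) ℝ (VV n), ∀ i, b i = liftV (w i) := by
  have hn' : (0:ℝ) < n := by exact_mod_cast hn
  have ho : Orthonormal ℝ (fun i => liftV (w i)) := by
    refine ⟨fun i => liftV_norm hn _ (hw.1 i), fun i j hij => ?_⟩
    change ⟪liftV (w i), liftV (w j)⟫ = 0
    rw [liftV_inner hn, hw.2 i j hij]
    field_simp
    norm_num
  have hcard : Fintype.card (Fin (n + 1)) = Module.finrank ℝ (VV n) := by simp [finrank_VV]
  let b0 := basisOfOrthonormalOfCardEqFinrank ho hcard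
  have hb0 : ⇑b0 = fun i => liftV (w i) := coe_basisOfOrthonormalOfCardEqFinrank ho hcard
  refine ⟨b0.toOrthonormalBasis (by rw [hb0]; exact ho), fun i => ?_⟩
  rw [Module.Basis.coe_toOrthonormalBasis, hb0]

lemma integral_hmax_basis_le {n : ℕ} (b : OrthonormalBasis (Fin (n + 1)) ℝ (VV n)) :
    ∫ Y, hmax b Y ∂(stdGaussian (VV n)) ≤ n + 1 := by
  have hgint : ∀ i, Integrable (fun Y => (1 + ⟪b i, Y⟫ ^ 2) / 2) (stdGaussian (VV n)) ∧
      ∫ Y, (1 + ⟪b i, Y⟫ ^ 2) / 2 ∂(stdGaussian (VV n)) = 1 := by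
    intro i
    have hm : MemLp (innerSL ℝ (b i)) 2 (stdGaussian (VV n)) := IsGaussian.memLp_dual _ _ _ (by simp)
    have hv := variance_dual_stdGaussian (innerSL ℝ (b i))
    rw [variance_of_integral_eq_zero (by fun_prop) (integral_strongDual_stdGaussian _)] at hv
    have hsq : Integrable (fun Y => ⟪b i, Y⟫ ^ 2) (stdGaussian (VV n)) := hm.integrable_sq
    have hv' : ∫ Y, ⟪b i, Y⟫ ^ 2 ∂(stdGaussian (VV n)) = 1 := by
      have : ‖innerSL ℝ (b i)‖ = 1 := by rw [innerSL_apply_norm, b.norm_eq_one]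
      rw [this] at hv
      simpa using hv
    refine ⟨((integrable_const _).add hsq).div_const _, ?_⟩
    rw [integral_div, integral_add (integrable_const _) hsq, hv']
    simp
  calc ∫ Y, hmax b Y ∂(stdGaussian (VV n)) ≤ ∫ Y, ∑ i, (1 + ⟪b i, Y⟫ ^ 2) / 2 ∂(stdGaussian (VV n)) := by
        apply integral_mono (hmax_integrable b fun i => b.norm_eq_one i)
          (integrable_finsetSum _ fun i _ => (hgint i).1)
        intro Y
        change hmax b Y ≤ _
        rw [hmax_le_iff]
        intro i
        calc ⟪b i, Y⟫ ≤ (1 + ⟪b i, Y⟫ ^ 2) / 2 := by nlinarith [sq_nonneg (1 - ⟪b i, Y⟫)]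
          _ ≤ _ := Finset.single_le_sum (f := fun i => (1 + ⟪b i, Y⟫ ^ 2) / 2)
            (fun i _ => by positivity) (Finset.mem_univ i)
    _ = n + 1 := by
        rw [integral_finsetSum _ fun i _ => (hgint i).1, Finset.sum_congr rfl fun i _ => (hgint i).2]
        simp

lemma pair_bound {n : ℕ} (hn : 1 ≤ n) {ι : Type*} [Fintype ι] [Nonempty ι]
    (u : ι → EuclideanSpace ℝ (Fin n)) (hu : ∀ i, ‖u i‖ = 1)
    (c : ι → ℝ) (hc : ∀ i, 0 < c i)
    (hiso : ∀ x : EuclideanSpace ℝ (Fin n), ‖x‖ ^ 2 = ∑ i, c i * ⟪u i, x⟫ ^ 2)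
    (hcent : ∑ i, c i • u i = 0)
    (w₀ : Fin (n + 1) → EuclideanSpace ℝ (Fin n)) (hw₀ : IsRegVerts w₀)
    (ε : ℝ) (hε0 : 0 < ε)
    (hℓ : ellNorm n (polarSet (convexHull ℝ (Set.range u))) ≤
      (1 + ε) * ellNorm n (polarSet (convexHull ℝ (Set.range w₀))))
    {δ : ℝ} (hδ : 0 ≤ δ) (i j : ι)
    (hi : δ ≤ (n + 1 : ℝ) / n * c i) (hj : δ ≤ (n + 1 : ℝ) / n * c j) :
    δ / 288 * (⟪liftV (u i), liftV (u j)⟫ ^ 2 * (1 / 10000 * ‖liftV (u i) - liftV (u j)‖) ^ 2) *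
        (1 / (2400 * (n + 1))) ^ (n + 1) / 2 ≤ ε * (n + 1) := by
  have hn' : (0:ℝ) < n := by exact_mod_cast hn
  by_cases hij : liftV (u i) = liftV (u j)
  · rw [hij]
    simp
    positivity
  set v : ι → VV n := fun i => liftV (u i) with hv
  have hvn : ∀ i, ‖v i‖ = 1 := fun i => liftV_norm hn _ (hu i)
  have hc' : ∀ i, 0 < (n + 1 : ℝ) / n * c i := fun i => mul_pos (by positivity) (hc i)
  have hviso := lift_iso hn u hu c hiso hcent
  obtain ⟨b, hb⟩ := regVerts_basis hn w₀ hw₀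
  have hm : 1 ≤ Module.finrank ℝ (VV n) := by rw [finrank_VV]; omega
  set d := δ / 288 * (⟪v i, v j⟫ ^ 2 * (1 / 10000 * ‖v i - v j‖) ^ 2) *
        (1 / (2400 * (n + 1))) ^ (n + 1) with hd
  have hd0 : 0 ≤ d := by positivity
  have hlay := layer_compare (stdGaussian (VV n)) (hmax v) (hmax b) (hmax_cont _).measurable
    (hmax_cont _).measurable (hmax_integrable v hvn) (hmax_integrable b fun i => b.norm_eq_one i)
    hd0 (fun t => by
      simp_rw [hmax_lt_iff]
      rw [gauss_orthonormal]
      have := bl_plain _ v hvn hviso hc' t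
      rw [finrank_VV] at this
      simpa using this) (fun t ht1 ht2 => by
      simp_rw [hmax_lt_iff]
      rw [gauss_orthonormal]
      have := bl_deficit hm _ v hvn hviso hc' ht1 ht2 hδ hij hi hj
      rw [finrank_VV] at this
      simpa [hd] using this)
  have hbw : (⇑b) = fun i => liftV (w₀ i) := funext hb
  have e1 := integral_hmax_lift u hu
  have e2 := integral_hmax_lift w₀ hw₀.1
  have e3 := integral_hmax_basis_le b
  rw [ellNorm_eq u c hc hcent, ellNorm_eq w₀ (fun _ => 1) (fun _ => one_pos)
    (by simpa using regVerts_sum hn w₀ hw₀)] at hℓ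
  rw [← hbw] at e2
  rw [← hv] at e1
  have hs : 0 ≤ √((n:ℝ) / (n + 1)) := Real.sqrt_nonneg _
  have := mul_le_mul_of_nonneg_left hℓ hs
  nlinarith
end

section
section selpart
variable {V : Type*} [NormedAddCommGroup V] [InnerProductSpace ℝ V] [FiniteDimensional ℝ V]
  [MeasurableSpace V] [BorelSpace V] {ι : Type*} [Fintype ι]

lemma norm_sub_sq_unit {V : Type*} [NormedAddCommGroup V] [InnerProductSpace ℝ V] {x y : V} (hx : ‖x‖ = 1) (hy : ‖y‖ = 1) :
    ‖x - y‖ ^ 2 = 2 - 2 * ⟪x, y⟫ := by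
  rw [norm_sub_sq_real, hx, hy]; ring

open Classical in
lemma select_indices (c : ι → ℝ) (v : ι → V) (hv : ∀ i, ‖v i‖ = 1)
    (hiso : ∀ x : V, ‖x‖ ^ 2 = ∑ i, c i * ⟪v i, x⟫ ^ 2) (hc : ∀ i, 0 < c i)
    {δ τ : ℝ} (hδ0 : 0 ≤ δ) (hδ : δ * Fintype.card ι ≤ 1 / 4) (hτ : 0 ≤ τ)
    (hτ2 : 4 * Module.finrank ℝ V * τ ^ 2 < 3 / 4)
    (hpair : ∀ i j, δ ≤ c i → δ ≤ c j → ⟪v i, v j⟫ ^ 2 * ‖v i - v j‖ ^ 2 ≤ τ ^ 2) :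
    ∃ idx : Fin (Module.finrank ℝ V) → ι, Function.Injective idx ∧
      ∀ a b, a ≠ b → |⟪v (idx a), v (idx b)⟫| ≤ τ := by
  let P : Finset ι → Prop := fun S => (∀ i ∈ S, δ ≤ c i) ∧ ∀ i ∈ S, ∀ j ∈ S, i ≠ j → ⟪v i, v j⟫ ≤ 1 / 2
  have hne : ((Finset.univ : Finset (Finset ι)).filter P).Nonempty := ⟨∅, by simp [P]⟩
  obtain ⟨S, hS, hmax⟩ := Finset.exists_max_image _ Finset.card hne
  have hSP : P S := (Finset.mem_filter.1 hS).2
  have hnear : ∀ i, δ ≤ c i → i ∉ S → ∃ j ∈ S, 1 / 2 < ⟪v i, v j⟫ := by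
    intro i hi hiS
    by_contra hcon
    push Not at hcon
    have : P (insert i S) := by
      refine ⟨?_, ?_⟩
      · intro a ha
        rcases Finset.mem_insert.1 ha with rfl | ha
        · exact hi
        · exact hSP.1 a ha
      · intro a ha b hb hab
        rcases Finset.mem_insert.1 ha with ha | ha <;> rcases Finset.mem_insert.1 hb with hb | hb
        · exact absurd (ha.trans hb.symm) hab
        · rw [ha]; exact hcon b hb
        · rw [hb, real_inner_comm]; exact hcon a ha
        · exact hSP.2 a ha b hb hab
    have := hmax (insert i S) (by simp [this])
    rw [Finset.card_insert_of_notMem hiS] at this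
    omega
  have hcard : Module.finrank ℝ V ≤ S.card := by
    by_contra hlt
    push Not at hlt
    set W := Submodule.span ℝ ((S.image v : Finset V) : Set V) with hW
    have h1 : Module.finrank ℝ W ≤ S.card :=
      (finrank_span_finset_le_card _).trans Finset.card_image_le
    have h2 := W.finrank_add_finrank_orthogonal
    have h3 : 0 < Module.finrank ℝ Wᗮ := by omega
    have : Nontrivial Wᗮ := Module.finrank_pos_iff.1 h3
    obtain ⟨⟨x, hxW⟩, hx0⟩ := exists_ne (0 : Wᗮ)
    have hx : x ≠ 0 := fun h => hx0 (by ext; simpa using h)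
    have hperp : ∀ j ∈ S, ⟪v j, x⟫ = 0 := fun j hj =>
      (Submodule.mem_orthogonal W x).1 hxW _ (Submodule.subset_span (by simpa using ⟨j, hj, rfl⟩))
    have hxp : 0 < ‖x‖ ^ 2 := by have := norm_pos_iff.2 hx; positivity
    have hterm : ∀ i, c i * ⟪v i, x⟫ ^ 2 ≤ (δ + c i * (4 * τ ^ 2)) * ‖x‖ ^ 2 := by
      intro i
      have hci := hc i
      by_cases hi : δ ≤ c i
      · by_cases hiS : i ∈ S
        · rw [hperp i hiS]
          have : 0 ≤ (δ + c i * (4 * τ ^ 2)) * ‖x‖ ^ 2 := by positivity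
          simpa using this
        · obtain ⟨j, hj, hij⟩ := hnear i hi hiS
          have hp := hpair i j hi (hSP.1 j hj)
          have hD : ‖v i - v j‖ ^ 2 ≤ 4 * τ ^ 2 := by
            have : (1/4 : ℝ) ≤ ⟪v i, v j⟫ ^ 2 := by nlinarith
            nlinarith [sq_nonneg ‖v i - v j‖]
          have hin : ⟪v i, x⟫ ^ 2 ≤ ‖v i - v j‖ ^ 2 * ‖x‖ ^ 2 := by
            have h := abs_real_inner_le_norm (v i - v j) x
            rw [inner_sub_left, hperp j hj, sub_zero] at h
            rw [← sq_abs, ← mul_pow]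
            gcongr
          calc c i * ⟪v i, x⟫ ^ 2 ≤ c i * (‖v i - v j‖ ^ 2 * ‖x‖ ^ 2) := by gcongr
            _ ≤ c i * ((4 * τ ^ 2) * ‖x‖ ^ 2) := by gcongr
            _ ≤ _ := by nlinarith [mul_nonneg hδ0 hxp.le]
      · push Not at hi
        have hin : ⟪v i, x⟫ ^ 2 ≤ ‖x‖ ^ 2 := by
          have h := abs_real_inner_le_norm (v i) x
          rw [hv, one_mul] at h
          rw [← sq_abs]
          gcongr
        calc c i * ⟪v i, x⟫ ^ 2 ≤ δ * ‖x‖ ^ 2 := by gcongr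
          _ ≤ _ := by
            have : 0 ≤ c i * (4 * τ ^ 2) * ‖x‖ ^ 2 := by positivity
            linarith
    have hsum := Finset.sum_le_sum fun i (_ : i ∈ Finset.univ) => hterm i
    rw [← hiso, ← Finset.sum_mul, Finset.sum_add_distrib, ← Finset.sum_mul, sum_c c v hv hiso] at hsum
    simp only [Finset.sum_const, nsmul_eq_mul, Finset.card_univ] at hsum
    nlinarith
  refine ⟨fun a => (S.equivFin.symm (Fin.castLE hcard a)).1, ?_, ?_⟩
  · intro a b hab
    have := S.equivFin.symm.injective (Subtype.ext hab)
    exact Fin.castLE_injective hcard this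
  · intro a b hab
    set i := S.equivFin.symm (Fin.castLE hcard a) with hi
    set j := S.equivFin.symm (Fin.castLE hcard b) with hj
    have hij : i.1 ≠ j.1 := by
      intro h
      have := S.equivFin.symm.injective (Subtype.ext h)
      exact hab (Fin.castLE_injective hcard this)
    have hle := hSP.2 i.1 i.2 j.1 j.2 hij
    have hp := hpair i.1 j.1 (hSP.1 _ i.2) (hSP.1 _ j.2)
    rw [norm_sub_sq_unit (hv _) (hv _)] at hp
    refine abs_le_of_sq_le_sq ?_ hτ
    nlinarith [sq_nonneg ⟪v i.1, v j.1⟫]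

end selpart

section polarpart
variable {V : Type*} [NormedAddCommGroup V] [InnerProductSpace ℝ V] [FiniteDimensional ℝ V]

lemma near_isometry (L : V →ₗ[ℝ] V) {ρ : ℝ} (hρ0 : 0 ≤ ρ) (hρ : ρ < 1)
    (hL : ∀ x, |‖L x‖ ^ 2 - ‖x‖ ^ 2| ≤ ρ * ‖x‖ ^ 2) :
    ∃ Q : V →ₗᵢ[ℝ] V, ∀ x, ‖Q x - L x‖ ≤ ρ * ‖x‖ := by
  have hsym : (L.adjoint ∘ₗ L).IsSymmetric := by
    intro x y
    simp [LinearMap.adjoint_inner_left, LinearMap.adjoint_inner_right]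
  let f := hsym.eigenvectorBasis rfl
  let s := fun i => ‖L (f i)‖
  have hs2 : ∀ i, |s i ^ 2 - 1| ≤ ρ := fun i => by
    have := hL (f i); rwa [f.norm_eq_one, one_pow, mul_one] at this
  have hs0 : ∀ i, 0 < s i := fun i => by
    have h1 := (abs_le.1 (hs2 i)).1
    have h2 : 0 ≤ s i := norm_nonneg _
    by_contra h
    have : s i = 0 := le_antisymm (not_lt.1 h) h2
    rw [this] at h1; norm_num at h1; linarith
  have hs1 : ∀ i, (1 - s i) ^ 2 ≤ ρ ^ 2 := fun i => by
    have h := hs2 i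
    have h2 := hs0 i
    have : |1 - s i| ≤ ρ := by
      refine le_trans ?_ h
      have e : s i ^ 2 - 1 = (s i - 1) * (s i + 1) := by ring
      rw [e, abs_mul, abs_sub_comm, abs_of_pos (show 0 < s i + 1 by linarith)]
      nlinarith [abs_nonneg (s i - 1)]
    rw [← sq_abs]; gcongr
  have hLo : ∀ i j, i ≠ j → ⟪L (f i), L (f j)⟫ = 0 := by
    intro i j hij
    have h1 : ⟪(L.adjoint ∘ₗ L) (f i), f j⟫ = ⟪L (f i), L (f j)⟫ := by
      simp [LinearMap.adjoint_inner_left]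
    rw [← h1, hsym.apply_eigenvectorBasis rfl i, inner_smul_left]
    have : ⟪f i, f j⟫ = 0 := f.orthonormal.2 hij
    change _ * ⟪f i, f j⟫ = 0
    rw [this, mul_zero]
  let g : Fin (Module.finrank ℝ V) → V := fun i => (s i)⁻¹ • L (f i)
  have hg : Orthonormal ℝ g := by
    refine ⟨fun i => ?_, fun i j hij => ?_⟩
    · change ‖(s i)⁻¹ • L (f i)‖ = 1
      rw [norm_smul, norm_inv, Real.norm_of_nonneg (hs0 i).le]
      exact inv_mul_cancel₀ (hs0 i).ne'
    · change ⟪(s i)⁻¹ • L (f i), (s j)⁻¹ • L (f j)⟫ = 0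
      rw [inner_smul_left, inner_smul_right, hLo i j hij]; simp
  have hLg : ∀ i, L (f i) = s i • g i := fun i => by
    change _ = s i • (s i)⁻¹ • L (f i)
    rw [smul_smul, mul_inv_cancel₀ (hs0 i).ne', one_smul]
  let Q0 : V →ₗ[ℝ] V := f.toBasis.constr ℝ g
  have hQ0 : ∀ i, Q0 (f i) = g i := fun i => by
    have := f.toBasis.constr_basis ℝ g i
    rwa [f.coe_toBasis] at this
  have hexp : ∀ x, x = ∑ i, ⟪f i, x⟫ • f i := fun x => (f.sum_repr' x).symm
  have hnx : ∀ x, ‖x‖ ^ 2 = ∑ i, ⟪f i, x⟫ ^ 2 := fun x => by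
    rw [← f.sum_sq_norm_inner_right x]; simp
  have hng : ∀ a : Fin (Module.finrank ℝ V) → ℝ, ‖∑ i, a i • g i‖ ^ 2 = ∑ i, a i ^ 2 := fun a => by
    rw [← real_inner_self_eq_norm_sq, hg.inner_sum]
    simp [sq]
  have hQx : ∀ x, Q0 x = ∑ i, ⟪f i, x⟫ • g i := fun x => by
    conv_lhs => rw [hexp x]
    simp [hQ0]
  have hLx : ∀ x, L x = ∑ i, (⟪f i, x⟫ * s i) • g i := fun x => by
    conv_lhs => rw [hexp x]
    simp only [map_sum, map_smul, hLg, smul_smul]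
  refine ⟨⟨Q0, fun x => ?_⟩, fun x => ?_⟩
  · have : ‖Q0 x‖ ^ 2 = ‖x‖ ^ 2 := by rw [hQx, hng, hnx]
    exact (sq_eq_sq₀ (norm_nonneg _) (norm_nonneg _)).1 this
  · change ‖Q0 x - L x‖ ≤ _
    have : ‖Q0 x - L x‖ ^ 2 ≤ (ρ * ‖x‖) ^ 2 := by
      rw [hQx, hLx, ← Finset.sum_sub_distrib]
      simp_rw [← sub_smul]
      rw [hng, mul_pow, hnx, Finset.mul_sum]
      apply Finset.sum_le_sum
      intro i _
      have := hs1 i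
      nlinarith [sq_nonneg ⟪f i, x⟫]
    exact (sq_le_sq₀ (norm_nonneg _) (by positivity)).1 this

end polarpart

lemma angle_le_norm_sub {V : Type*} [NormedAddCommGroup V] [InnerProductSpace ℝ V] {x y : V}
    (hx : ‖x‖ = 1) (hy : ‖y‖ = 1) :
    InnerProductGeometry.angle x y ≤ Real.pi / 2 * ‖x - y‖ := by
  set θ := InnerProductGeometry.angle x y with hθ
  have h0 : 0 ≤ θ := InnerProductGeometry.angle_nonneg x y
  have hpi : θ ≤ Real.pi := InnerProductGeometry.angle_le_pi x y
  have hcos : Real.cos θ = ⟪x, y⟫ := by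
    rw [hθ, InnerProductGeometry.cos_angle, hx, hy]; simp
  have h := Real.cos_le_one_sub_mul_cos_sq (x := θ) (by rwa [abs_of_nonneg h0])
  have hn : ‖x - y‖ ^ 2 = 2 - 2 * ⟪x, y⟫ := by rw [norm_sub_sq_real, hx, hy]; ring
  have hp := Real.pi_pos
  have : θ ^ 2 ≤ (Real.pi / 2 * ‖x - y‖) ^ 2 := by
    rw [mul_pow, hn, ← hcos]
    have h' : 2 / Real.pi ^ 2 * θ ^ 2 ≤ 1 - Real.cos θ := by linarith
    calc θ ^ 2 = (Real.pi / 2) ^ 2 * (2 * (2 / Real.pi ^ 2 * θ ^ 2)) := by field_simp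
      _ ≤ (Real.pi / 2) ^ 2 * (2 * (1 - Real.cos θ)) := by gcongr
      _ = _ := by ring
  exact (sq_le_sq₀ h0 (by positivity)).1 this

lemma regVerts_parseval {n : ℕ} (hn : 1 ≤ n) (w : Fin (n + 1) → EuclideanSpace ℝ (Fin n))
    (hw : IsRegVerts w) (x : EuclideanSpace ℝ (Fin n)) :
    ∑ j, ⟪w j, x⟫ ^ 2 = (n + 1 : ℝ) / n * ‖x‖ ^ 2 := by
  have hn' : (0:ℝ) < n := by exact_mod_cast hn
  obtain ⟨b, hb⟩ := regVerts_basis hn w hw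
  have h := b.sum_sq_norm_inner_right (WithLp.toLp 2 (x, (0:ℝ)))
  have hnorm : ‖(WithLp.toLp 2 (x, 0) : VV n)‖ = ‖x‖ := by simp
  rw [hnorm] at h
  have ht : ∀ j, ‖⟪b j, (WithLp.toLp 2 (x, 0) : VV n)⟫‖ ^ 2 = (n:ℝ) / (n + 1) * ⟪w j, x⟫ ^ 2 := by
    intro j
    rw [hb, liftV_inner_right, Real.norm_eq_abs, sq_abs, mul_pow, Real.sq_sqrt (by positivity)]
    simp
  simp_rw [ht] at h
  rw [← Finset.mul_sum] at h
  rw [← h]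
  field_simp

lemma near_simplex {n : ℕ} (hn : 1 ≤ n) (w : Fin (n + 1) → EuclideanSpace ℝ (Fin n))
    (hw : IsRegVerts w) (u : Fin (n + 1) → EuclideanSpace ℝ (Fin n)) (hu : ∀ i, ‖u i‖ = 1)
    {σ : ℝ} (hσ0 : 0 ≤ σ) (hσ : n * σ < 1)
    (huu : ∀ i j, i ≠ j → |⟪u i, u j⟫ + 1 / n| ≤ σ) :
    ∃ w' : Fin (n + 1) → EuclideanSpace ℝ (Fin n), IsRegVerts w' ∧
      ∀ j, ‖u j - w' j‖ ≤ √σ + n * σ := by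
  have hn' : (0:ℝ) < n := by exact_mod_cast hn
  let R : Fin (n + 1) → Fin (n + 1) → ℝ := fun i j => ⟪u i, u j⟫ + 1 / n - if i = j then (n + 1 : ℝ) / n else 0
  have hR : ∀ i j, |R i j| ≤ σ := by
    intro i j
    by_cases hij : i = j
    · subst hij
      have : R i i = 0 := by
        simp only [R, if_true, real_inner_self_eq_norm_sq, hu]; field_simp; norm_num
      rw [this, abs_zero]; exact hσ0
    · simpa [R, hij] using huu i j hij
  have huR : ∀ i j, ⟪u i, u j⟫ = R i j - 1 / n + if i = j then (n + 1 : ℝ) / n else 0 := fun i j => by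
    simp only [R]; ring
  have hquad : ∀ a : Fin (n + 1) → ℝ, ‖∑ j, a j • u j‖ ^ 2 =
      (∑ i, ∑ j, R i j * (a i * a j)) - 1 / n * (∑ i, a i) ^ 2 + (n + 1 : ℝ) / n * ∑ i, a i ^ 2 := by
    intro a
    rw [← real_inner_self_eq_norm_sq, sum_inner]
    simp_rw [inner_sum, inner_smul_left, inner_smul_right, huR]
    rw [sq (∑ i, a i), Finset.sum_mul_sum, Finset.mul_sum, Finset.mul_sum, ← Finset.sum_sub_distrib,
      ← Finset.sum_add_distrib]
    apply Finset.sum_congr rfl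
    intro i _
    have : (n + 1 : ℝ) / n * a i ^ 2 = ∑ j, if i = j then (n + 1 : ℝ) / n * (a i * a j) else 0 := by
      simp [sq]
    rw [this, Finset.mul_sum, ← Finset.sum_sub_distrib, ← Finset.sum_add_distrib]
    apply Finset.sum_congr rfl
    intro j _
    split_ifs <;> simp <;> ring
  have hRa : ∀ a : Fin (n + 1) → ℝ, |∑ i, ∑ j, R i j * (a i * a j)| ≤ σ * (n + 1) * ∑ i, a i ^ 2 := by
    intro a
    calc |∑ i, ∑ j, R i j * (a i * a j)| ≤ ∑ i, ∑ j, σ * (|a i| * |a j|) := by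
          refine (Finset.abs_sum_le_sum_abs _ _).trans (Finset.sum_le_sum fun i _ => ?_)
          refine (Finset.abs_sum_le_sum_abs _ _).trans (Finset.sum_le_sum fun j _ => ?_)
          rw [abs_mul, abs_mul]
          have := hR i j
          gcongr
      _ = σ * (∑ i, |a i|) ^ 2 := by
          rw [sq, Finset.sum_mul_sum, Finset.mul_sum]
          simp_rw [Finset.mul_sum]
      _ ≤ σ * ((n + 1) * ∑ i, |a i| ^ 2) := by
          have := sq_sum_le_card_mul_sum_sq (s := (Finset.univ : Finset (Fin (n + 1)))) (f := fun i => |a i|)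
          simp only [Finset.card_univ, Fintype.card_fin] at this
          push_cast at this
          gcongr
      _ = _ := by simp only [sq_abs]; ring
  let L : EuclideanSpace ℝ (Fin n) →ₗ[ℝ] EuclideanSpace ℝ (Fin n) :=
    ((n:ℝ) / (n + 1)) • ∑ j, (innerₛₗ ℝ (w j)).smulRight (u j)
  have hLx : ∀ x, L x = ((n:ℝ) / (n + 1)) • ∑ j, ⟪w j, x⟫ • u j := by
    intro x
    simp [L]
  have hw0 := regVerts_sum hn w hw
  have hL : ∀ x, |‖L x‖ ^ 2 - ‖x‖ ^ 2| ≤ (n * σ) * ‖x‖ ^ 2 := by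
    intro x
    have ha0 : ∑ j, ⟪w j, x⟫ = 0 := by rw [← sum_inner, hw0, inner_zero_left]
    have ha := regVerts_parseval hn w hw x
    have hr := hRa fun j => ⟪w j, x⟫
    rw [hLx, norm_smul, mul_pow, hquad, ha0, ha]
    rw [ha] at hr
    rw [Real.norm_of_nonneg (by positivity)]
    set T := ∑ i, ∑ j, R i j * (⟪w i, x⟫ * ⟪w j, x⟫)
    have e : ((n:ℝ) / (n + 1)) ^ 2 * (T - 1 / n * 0 ^ 2 + (n + 1) / n * ((n + 1) / n * ‖x‖ ^ 2)) - ‖x‖ ^ 2 =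
        ((n:ℝ) / (n + 1)) ^ 2 * T := by
      field_simp; ring
    rw [e, abs_mul, abs_of_nonneg (by positivity)]
    calc ((n:ℝ) / (n + 1)) ^ 2 * |T| ≤ ((n:ℝ) / (n + 1)) ^ 2 * (σ * (n + 1) * ((n + 1) / n * ‖x‖ ^ 2)) := by gcongr
      _ = _ := by field_simp
  obtain ⟨Q, hQ⟩ := near_isometry L (by positivity) hσ hL
  refine ⟨fun j => Q (w j), ⟨fun i => by rw [Q.norm_map, hw.1], fun i j hij => by
    rw [Q.inner_map_map, hw.2 i j hij]⟩, fun j => ?_⟩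
  have hS : ‖∑ i, u i‖ ≤ (n + 1) * √σ := by
    have h1 := hquad fun _ => 1
    have h2 := (abs_le.1 (hRa fun _ => 1)).2
    simp only [one_smul, Finset.sum_const, Finset.card_univ, Fintype.card_fin, nsmul_eq_mul, one_pow,
      mul_one] at h1 h2
    push_cast at h1 h2
    have h3 : ‖∑ i, u i‖ ^ 2 ≤ ((n + 1) * √σ) ^ 2 := by
      rw [mul_pow, Real.sq_sqrt hσ0]
      have : -(1 / (n:ℝ) * (n + 1) ^ 2) + (n + 1) / n * (n + 1) = 0 := by field_simp; ring
      nlinarith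
    exact (sq_le_sq₀ (norm_nonneg _) (by positivity)).1 h3
  have hLw : L (w j) = u j - (1 / (n + 1 : ℝ)) • ∑ i, u i := by
    have h1 : ∀ i, ⟪w i, w j⟫ • u i = (if i = j then ((n + 1 : ℝ) / n) • u i else 0) - (1 / (n:ℝ)) • u i := by
      intro i
      by_cases hij : i = j
      · subst hij
        rw [real_inner_self_eq_norm_sq, hw.1, if_pos rfl, ← sub_smul]
        congr 1; field_simp; ring
      · rw [hw.2 i j hij, if_neg hij, zero_sub, ← neg_smul]; congr 1; ring
    rw [hLx]
    simp_rw [h1]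
    rw [Finset.sum_sub_distrib, Finset.sum_ite_eq' , if_pos (Finset.mem_univ _), ← Finset.smul_sum, smul_sub, smul_smul, smul_smul]
    congr 1
    · rw [show (n:ℝ) / (n + 1) * ((n + 1) / n) = 1 by field_simp, one_smul]
    · congr 1; field_simp
  have h1 : ‖u j - L (w j)‖ ≤ √σ := by
    rw [hLw, sub_sub_cancel, norm_smul, Real.norm_of_nonneg (by positivity)]
    calc 1 / (n + 1 : ℝ) * ‖∑ i, u i‖ ≤ 1 / (n + 1 : ℝ) * ((n + 1) * √σ) := by gcongr
      _ = √σ := by field_simp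
  have h2 := hQ (w j)
  rw [hw.1, mul_one, norm_sub_rev] at h2
  calc ‖u j - Q (w j)‖ = ‖(u j - L (w j)) + (L (w j) - Q (w j))‖ := by rw [sub_add_sub_cancel]
    _ ≤ _ := norm_add_le _ _
    _ ≤ _ := add_le_add h1 h2
end

lemma const_bound {n : ℕ} (hn : 2 ≤ n) :
    625 * (n:ℝ) ^ 8 * (460800000000 * n ^ 2 * (n + 1) * (2400 * (n + 1)) ^ (n + 1)) ≤ (n:ℝ) ^ (60 * n) := by
  have hn' : (2:ℝ) ≤ n := by exact_mod_cast hn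
  have h1 : (1:ℝ) ≤ n := by linarith
  have hpow : ∀ e : ℕ, (2:ℝ) ^ e ≤ (n:ℝ) ^ e := fun e => by gcongr
  have a1 : (625 * 460800000000 : ℝ) ≤ (n:ℝ) ^ 49 := le_trans (by norm_num) (hpow 49)
  have a2 : (n + 1 : ℝ) ≤ (n:ℝ) ^ 2 := by nlinarith
  have a3 : (2400 * (n + 1) : ℝ) ≤ (n:ℝ) ^ 13 := by
    have := hpow 12
    have : (2400 * (n + 1) : ℝ) ≤ 2 ^ 12 * n := by norm_num; linarith
    calc (2400 * (n + 1) : ℝ) ≤ 2 ^ 12 * n := this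
      _ ≤ (n:ℝ) ^ 12 * n := by gcongr
      _ = _ := by ring
  calc 625 * (n:ℝ) ^ 8 * (460800000000 * n ^ 2 * (n + 1) * (2400 * (n + 1)) ^ (n + 1))
      = (625 * 460800000000) * n ^ 10 * (n + 1) * (2400 * (n + 1)) ^ (n + 1) := by ring
    _ ≤ (n:ℝ) ^ 49 * n ^ 10 * n ^ 2 * ((n:ℝ) ^ 13) ^ (n + 1) := by gcongr
    _ = (n:ℝ) ^ (74 + 13 * n) := by
        rw [← pow_mul, ← pow_add, ← pow_add, ← pow_add]; congr 1; ring
    _ ≤ _ := pow_le_pow_right₀ h1 (by omega)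

lemma eta_props {n : ℕ} (hn : 1 ≤ n) {ε : ℝ} (hε0 : 0 < ε) (hε1 : ε < ((n : ℝ) ^ (60 * n))⁻¹) :
    (0 < (n : ℝ) ^ (15 * n) * ε ^ ((1 : ℝ) / 4) ∧ (n : ℝ) ^ (15 * n) * ε ^ ((1 : ℝ) / 4) < 1) ∧
    ((n : ℝ) ^ (15 * n) * ε ^ ((1 : ℝ) / 4)) ^ 4 = (n:ℝ) ^ (60 * n) * ε := by
  have hn' : (0:ℝ) < n := by exact_mod_cast hn
  have h4 : ((n : ℝ) ^ (15 * n) * ε ^ ((1 : ℝ) / 4)) ^ 4 = (n:ℝ) ^ (60 * n) * ε := by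
    rw [mul_pow, ← pow_mul, ← Real.rpow_natCast (ε ^ _), ← Real.rpow_mul hε0.le]
    norm_num
    left; congr 1; ring
  have hpos : 0 < (n : ℝ) ^ (15 * n) * ε ^ ((1 : ℝ) / 4) := by positivity
  refine ⟨⟨hpos, ?_⟩, h4⟩
  have hlt : ((n : ℝ) ^ (15 * n) * ε ^ ((1 : ℝ) / 4)) ^ 4 < 1 ^ 4 := by
    rw [h4, one_pow]
    calc (n:ℝ) ^ (60 * n) * ε < (n:ℝ) ^ (60 * n) * ((n : ℝ) ^ (60 * n))⁻¹ := by gcongr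
      _ = 1 := mul_inv_cancel₀ (by positivity)
  exact lt_of_pow_lt_pow_left₀ 4 (by norm_num) hlt

theorem almost_regular_simplex_of_polar_ell_small
    (n k : ℕ) (hn : 1 ≤ n) (hk₁ : n + 1 ≤ k) (hk₂ : k ≤ 2 * n ^ 2)
    (u : Fin k → EuclideanSpace ℝ (Fin n)) (hu : ∀ i, ‖u i‖ = 1)
    (c : Fin k → ℝ) (hc : ∀ i, 0 < c i)
    (hiso : ∀ x : EuclideanSpace ℝ (Fin n), ‖x‖ ^ 2 = ∑ i, c i * ⟪u i, x⟫ ^ 2)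
    (hcent : ∑ i, c i • u i = 0)
    (w₀ : Fin (n + 1) → EuclideanSpace ℝ (Fin n)) (hw₀ : IsRegVerts w₀)
    (ε : ℝ) (hε0 : 0 < ε) (hε1 : ε < ((n : ℝ) ^ (60 * n))⁻¹)
    (hℓ : ellNorm n (polarSet (convexHull ℝ (Set.range u))) ≤
      (1 + ε) * ellNorm n (polarSet (convexHull ℝ (Set.range w₀)))) :
    (0 < (n : ℝ) ^ (15 * n) * ε ^ ((1 : ℝ) / 4) ∧ (n : ℝ) ^ (15 * n) * ε ^ ((1 : ℝ) / 4) < 1) ∧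
    ∃ w : Fin (n + 1) → EuclideanSpace ℝ (Fin n), IsRegVerts w ∧
      ∃ idx : Fin (n + 1) → Fin k, Function.Injective idx ∧
        ∀ j, InnerProductGeometry.angle (u (idx j)) (w j) ≤
          (n : ℝ) ^ (15 * n) * ε ^ ((1 : ℝ) / 4) := by
  obtain ⟨hη, hη4⟩ := eta_props hn hε0 hε1
  refine ⟨hη, ?_⟩
  set η := (n : ℝ) ^ (15 * n) * ε ^ ((1 : ℝ) / 4) with hηdef
  rcases Nat.lt_or_ge n 2 with hn1 | hn2
  · obtain rfl : n = 1 := by omega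
    obtain rfl : k = 2 := by omega
    have hc01 : c 0 • u 0 = - (c 1 • u 1) := by
      rw [Fin.sum_univ_two] at hcent
      exact eq_neg_of_add_eq_zero_left hcent
    have hcc : c 0 = c 1 := by
      have := congrArg norm hc01
      rwa [norm_neg, norm_smul, norm_smul, hu, hu, mul_one, mul_one, Real.norm_of_nonneg (hc 0).le,
        Real.norm_of_nonneg (hc 1).le] at this
    have huu : u 0 = - u 1 := by
      rw [hcc, ← smul_neg] at hc01
      exact smul_right_injective _ (hc 1).ne' hc01
    have hin : ⟪u 0, u 1⟫ = -1 := by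
      rw [huu, inner_neg_left, real_inner_self_eq_norm_sq, hu]; norm_num
    refine ⟨fun j => u j, ⟨fun i => hu i, ?_⟩, fun j => j, fun a b h => h, fun j => ?_⟩
    · have hin' : ⟪u 1, u 0⟫ = -1 := by rw [real_inner_comm]; exact hin
      intro i j hij
      change Fin 2 at i j
      fin_cases i <;> fin_cases j
      · exact absurd rfl hij
      · simpa using hin
      · simpa using hin'
      · exact absurd rfl hij
    · have h0 : u j ≠ 0 := fun h => by
        have := hu j
        rw [h] at this
        simp at this
      rw [InnerProductGeometry.angle_self h0]
      exact hη.1.le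
  have hn' : (2:ℝ) ≤ n := by exact_mod_cast hn2
  have hn0 : (0:ℝ) < n := by linarith
  have hne : Nonempty (Fin k) := ⟨⟨0, by omega⟩⟩
  set δ : ℝ := 1 / (8 * n ^ 2) with hδ
  have hδ0 : 0 < δ := by positivity
  set B : ℝ := 460800000000 * n ^ 2 * (n + 1) * (2400 * (n + 1)) ^ (n + 1) with hB
  have hB0 : 0 < B := by positivity
  set τ : ℝ := √(B * ε) with hτ
  have hτ0 : 0 ≤ τ := Real.sqrt_nonneg _
  have hτsq : τ ^ 2 = B * ε := Real.sq_sqrt (by positivity)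
  have hbig : 625 * (n:ℝ) ^ 8 * τ ^ 2 ≤ η ^ 4 := by
    rw [hη4, hτsq]
    have := mul_le_mul_of_nonneg_right (const_bound hn2) hε0.le
    rw [← hB] at this
    linarith
  have hη1 : η ^ 4 ≤ 1 := pow_le_one₀ hη.1.le hη.2.le
  have hn8 : (1:ℝ) ≤ (n:ℝ) ^ 8 := one_le_pow₀ (by linarith)
  have hn84 : (n:ℝ) ^ 4 ≤ (n:ℝ) ^ 8 := pow_le_pow_right₀ (by linarith) (by norm_num)
  have hn81 : (n:ℝ) ≤ (n:ℝ) ^ 8 := by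
    calc (n:ℝ) = (n:ℝ) ^ 1 := (pow_one _).symm
      _ ≤ _ := pow_le_pow_right₀ (by linarith) (by norm_num)
  have hτ2 : 0 ≤ τ ^ 2 := sq_nonneg τ
  -- pair estimate
  have hpair : ∀ i j, δ ≤ (n + 1 : ℝ) / n * c i → δ ≤ (n + 1 : ℝ) / n * c j →
      ⟪liftV (u i), liftV (u j)⟫ ^ 2 * ‖liftV (u i) - liftV (u j)‖ ^ 2 ≤ τ ^ 2 := by
    intro i j hi hj
    have h := pair_bound hn u hu c hc hiso hcent w₀ hw₀ ε hε0 hℓ hδ0.le i j hi hj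
    set X := ⟪liftV (u i), liftV (u j)⟫ ^ 2
    set D := ‖liftV (u i) - liftV (u j)‖
    rw [hτsq, hB]
    have hK : (0:ℝ) < (2400 * (n + 1)) ^ (n + 1) := by positivity
    rw [one_div_pow] at h
    set K : ℝ := (2400 * (n + 1)) ^ (n + 1)
    have e : δ / 288 * (X * (1 / 10000 * D) ^ 2) * (1 / K) / 2 =
        (X * D ^ 2) / (460800000000 * n ^ 2 * K) := by
      rw [hδ]; field_simp; ring
    rw [e, div_le_iff₀ (by positivity)] at h
    linarith
  have hsel := select_indices (fun i => (n + 1 : ℝ) / n * c i) (fun i => liftV (u i))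
    (fun i => liftV_norm hn _ (hu i)) (lift_iso hn u hu c hiso hcent)
    (fun i => mul_pos (by positivity) (hc i)) hδ0.le
    (by
      rw [Fintype.card_fin, hδ, div_mul_eq_mul_div, div_le_iff₀ (by positivity)]
      have : (k:ℝ) ≤ 2 * n ^ 2 := by exact_mod_cast hk₂
      linarith) hτ0
    (by
      rw [finrank_VV]
      push_cast
      nlinarith) hpair
  rw [finrank_VV] at hsel
  obtain ⟨idx, hinj, hidx⟩ := hsel
  have hσ : ∀ a b, a ≠ b → |⟪u (idx a), u (idx b)⟫ + 1 / n| ≤ 2 * τ := by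
    intro a b hab
    have h := hidx a b hab
    rw [liftV_inner hn, abs_mul, abs_of_nonneg (by positivity), div_mul_eq_mul_div, div_le_iff₀ (by positivity)] at h
    have h0 := abs_nonneg (⟪u (idx a), u (idx b)⟫ + 1 / (n:ℝ))
    by_contra hcon
    push Not at hcon
    nlinarith
  have hnτ : 2 * τ * n ^ 2 < 1 := by
    have : (2 * τ * n ^ 2) ^ 2 < 1 ^ 2 := by
      have e : (2 * τ * n ^ 2) ^ 2 = 4 * (n:ℝ) ^ 4 * τ ^ 2 := by ring
      rw [e]
      nlinarith
    exact lt_of_pow_lt_pow_left₀ 2 (by norm_num) this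
  obtain ⟨w, hw, hwd⟩ := near_simplex hn w₀ hw₀ (fun j => u (idx j)) (fun j => hu _) (σ := 2 * τ)
    (by positivity) (by nlinarith) hσ
  refine ⟨w, hw, idx, hinj, fun j => ?_⟩
  have hang := angle_le_norm_sub (hu (idx j)) (hw.1 j)
  have hd := hwd j
  set r := √(2 * τ) with hr
  have hr0 : 0 ≤ r := Real.sqrt_nonneg _
  have hr2 : r ^ 2 = 2 * τ := Real.sq_sqrt (by positivity)
  have hnr : n * r ≤ 1 := by
    have : (n * r) ^ 2 ≤ 1 ^ 2 := by rw [mul_pow, hr2]; nlinarith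
    exact le_of_sq_le_sq this (by norm_num)
  have hd2 : ‖u (idx j) - w j‖ ≤ 2 * r := by
    refine hd.trans ?_
    rw [← hr2]
    nlinarith
  have hfin : Real.pi * r ≤ η := by
    have h4 : (Real.pi * r) ^ 4 ≤ η ^ 4 := by
      refine le_trans ?_ hbig
      have e : (Real.pi * r) ^ 4 = Real.pi ^ 4 * 4 * τ ^ 2 := by
        have : (Real.pi * r) ^ 4 = Real.pi ^ 4 * (r ^ 2) ^ 2 := by ring
        rw [this, hr2]; ring
      rw [e]
      have hp : Real.pi ^ 4 ≤ 3.15 ^ 4 := by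
        have := Real.pi_lt_d2
        have := Real.pi_pos
        gcongr
      have : Real.pi ^ 4 * 4 ≤ 625 * (n:ℝ) ^ 8 := by norm_num at hp; linarith
      gcongr
    exact le_of_pow_le_pow_left₀ (by norm_num) hη.1.le h4
  calc _ ≤ _ := hang
    _ ≤ Real.pi / 2 * (2 * r) := by have := Real.pi_pos; gcongr
    _ = Real.pi * r := by ring
    _ ≤ η := hfin

end
end

section
/- If K and C are convex bodies in ℝ^n with (1/n)B^n ⊆ K ⊆ nB^n and (1/n)B^n ⊆ C ⊆ nB^n, then (1/n²)·δ_H(K, C) ≤ δ_H(K°, C°) ≤ n²·δ_H(K, C). -/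
open MeasureTheory Metric Set
open scoped RealInnerProductSpace Pointwise

noncomputable section

theorem polarSet_subset_closedBall {n : ℕ} (hn : 1 ≤ n) {K : Set (EuclideanSpace ℝ (Fin n))}
    (hK : closedBall (0 : EuclideanSpace ℝ (Fin n)) ((n : ℝ)⁻¹) ⊆ K) :
    polarSet K ⊆ closedBall (0 : EuclideanSpace ℝ (Fin n)) n := by
  intro x hx
  have hn0 : (0 : ℝ) < n := by exact_mod_cast hn
  rw [mem_closedBall_zero_iff]
  rcases eq_or_ne x 0 with rfl | hx0
  · simp
  have hpos : 0 < ‖x‖ := norm_pos_iff.2 hx0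
  have h1 := hx (((n : ℝ)⁻¹ * ‖x‖⁻¹) • x) (hK (by
    rw [mem_closedBall_zero_iff, norm_smul, Real.norm_eq_abs, abs_of_pos (by positivity),
      mul_assoc, inv_mul_cancel₀ hpos.ne', mul_one]))
  rw [inner_smul_right, real_inner_self_eq_norm_sq] at h1
  have h2 : (n : ℝ)⁻¹ * ‖x‖⁻¹ * ‖x‖ ^ 2 = ‖x‖ / n := by field_simp
  rw [h2, div_le_one hn0] at h1
  exact h1

theorem closedBall_subset_polarSet {n : ℕ} (hn : 1 ≤ n) {K : Set (EuclideanSpace ℝ (Fin n))}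
    (hK : K ⊆ closedBall (0 : EuclideanSpace ℝ (Fin n)) n) :
    closedBall (0 : EuclideanSpace ℝ (Fin n)) ((n : ℝ)⁻¹) ⊆ polarSet K := by
  intro x hx y hy
  have hn0 : (0 : ℝ) < n := by exact_mod_cast hn
  have hy' := hK hy
  rw [mem_closedBall_zero_iff] at hx hy'
  calc ⟪x, y⟫ ≤ ‖x‖ * ‖y‖ := real_inner_le_norm x y
    _ ≤ (n : ℝ)⁻¹ * n := by gcongr
    _ = 1 := inv_mul_cancel₀ hn0.ne'

theorem polarSet_polarSet {n : ℕ} {K : Set (EuclideanSpace ℝ (Fin n))}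
    (hc : IsClosed K) (hv : Convex ℝ K) (h0 : (0 : EuclideanSpace ℝ (Fin n)) ∈ K) :
    polarSet (polarSet K) = K := by
  ext x
  constructor
  · intro hx
    by_contra hxK
    obtain ⟨f, u, hf, hu⟩ := geometric_hahn_banach_closed_point hv hc hxK
    have hu0 : 0 < u := by simpa using hf 0 h0
    obtain ⟨w, rfl⟩ := (InnerProductSpace.toDual ℝ (EuclideanSpace ℝ (Fin n))).surjective f
    simp only [InnerProductSpace.toDual_apply_apply] at hf hu
    have hw : u⁻¹ • w ∈ polarSet K := by
      intro y hy
      rw [real_inner_smul_left, inv_mul_le_one₀ hu0]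
      exact (hf y hy).le
    have := hx _ hw
    rw [real_inner_smul_right, inv_mul_le_one₀ hu0, real_inner_comm] at this
    linarith
  · intro hx y hy
    rw [real_inner_comm]
    exact hy x hx

theorem exists_polar_near {n : ℕ} (hn : 1 ≤ n) {K C : Set (EuclideanSpace ℝ (Fin n))}
    (hK : closedBall (0 : EuclideanSpace ℝ (Fin n)) ((n : ℝ)⁻¹) ⊆ K) {d : ℝ} (hd : 0 ≤ d)
    (h : ∀ y ∈ C, ∃ z ∈ K, dist y z ≤ d) :
    ∀ x ∈ polarSet K, ∃ z ∈ polarSet C, dist x z ≤ (n : ℝ) ^ 2 * d := by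
  intro x hx
  have hxn : ‖x‖ ≤ n := mem_closedBall_zero_iff.1 (polarSet_subset_closedBall hn hK hx)
  have hn0 : (0 : ℝ) < n := by exact_mod_cast hn
  have hs : 0 < 1 + n * d := by positivity
  refine ⟨(1 + n * d)⁻¹ • x, ?_, ?_⟩
  · intro y hy
    obtain ⟨z, hz, hyz⟩ := h y hy
    rw [real_inner_smul_left, inv_mul_le_one₀ hs]
    have h1 : ⟪x, y⟫ = ⟪x, z⟫ + ⟪x, y - z⟫ := by rw [inner_sub_right]; ring
    have h2 : ⟪x, y - z⟫ ≤ n * d := (real_inner_le_norm _ _).trans (by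
      rw [dist_eq_norm] at hyz
      gcongr)
    have := hx z hz
    linarith
  · have h1 : x - (1 + n * d)⁻¹ • x = ((n * d) * (1 + n * d)⁻¹) • x := by
      have : (n * d) * (1 + n * d)⁻¹ = 1 - (1 + n * d)⁻¹ := by field_simp; ring
      rw [this, sub_smul, one_smul]
    rw [dist_eq_norm, h1, norm_smul, Real.norm_eq_abs, abs_of_nonneg (by positivity)]
    have h2 : (1 + n * d)⁻¹ ≤ 1 := inv_le_one_of_one_le₀ (by nlinarith [mul_nonneg hn0.le hd])
    calc (n * d) * (1 + n * d)⁻¹ * ‖x‖ ≤ (n * d) * 1 * n := by gcongr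
      _ = (n : ℝ) ^ 2 * d := by ring

theorem hausdorffDist_polar_le {n : ℕ} (hn : 1 ≤ n) {K C : Set (EuclideanSpace ℝ (Fin n))}
    (hK₁ : closedBall (0 : EuclideanSpace ℝ (Fin n)) ((n : ℝ)⁻¹) ⊆ K)
    (hK₂ : K ⊆ closedBall (0 : EuclideanSpace ℝ (Fin n)) n)
    (hC₁ : closedBall (0 : EuclideanSpace ℝ (Fin n)) ((n : ℝ)⁻¹) ⊆ C)
    (hC₂ : C ⊆ closedBall (0 : EuclideanSpace ℝ (Fin n)) n) :
    hausdorffDist (polarSet K) (polarSet C) ≤ (n : ℝ) ^ 2 * hausdorffDist K C := by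
  have hn0 : (0 : ℝ) < n := by exact_mod_cast hn
  have h0 : (0 : EuclideanSpace ℝ (Fin n)) ∈ closedBall 0 ((n : ℝ)⁻¹) :=
    mem_closedBall_self (by positivity)
  have hfin : hausdorffEDist K C ≠ ⊤ :=
    hausdorffEDist_ne_top_of_nonempty_of_bounded ⟨0, hK₁ h0⟩ ⟨0, hC₁ h0⟩
      (isBounded_closedBall.subset hK₂) (isBounded_closedBall.subset hC₂)
  have key : ∀ d, hausdorffDist K C < d →
      hausdorffDist (polarSet K) (polarSet C) ≤ (n : ℝ) ^ 2 * d := by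
    intro d hd
    have hd0 : 0 ≤ d := hausdorffDist_nonneg.trans hd.le
    refine hausdorffDist_le_of_mem_dist (by positivity) ?_ ?_
    · refine exists_polar_near hn hK₁ hd0 fun y hy => ?_
      obtain ⟨z, hz, h⟩ := exists_dist_lt_of_hausdorffDist_lt' hy hd hfin
      exact ⟨z, hz, by rw [dist_comm]; exact h.le⟩
    · refine exists_polar_near hn hC₁ hd0 fun y hy => ?_
      obtain ⟨z, hz, h⟩ := exists_dist_lt_of_hausdorffDist_lt hy hd hfin
      exact ⟨z, hz, h.le⟩
  have hn2 : (0 : ℝ) < (n : ℝ) ^ 2 := by positivity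
  rw [← div_le_iff₀' hn2]
  refine le_of_forall_gt_imp_ge_of_dense fun d hd => ?_
  rw [div_le_iff₀' hn2]
  exact key d hd

theorem hausdorffDist_polar_comparison
    (n : ℕ) (hn : 1 ≤ n) (K C : Set (EuclideanSpace ℝ (Fin n)))
    (hKcomp : IsCompact K) (hKconv : Convex ℝ K) (hKint : (interior K).Nonempty)
    (hCcomp : IsCompact C) (hCconv : Convex ℝ C) (hCint : (interior C).Nonempty)
    (hK₁ : closedBall (0 : EuclideanSpace ℝ (Fin n)) ((n : ℝ)⁻¹) ⊆ K)
    (hK₂ : K ⊆ closedBall (0 : EuclideanSpace ℝ (Fin n)) n)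
    (hC₁ : closedBall (0 : EuclideanSpace ℝ (Fin n)) ((n : ℝ)⁻¹) ⊆ C)
    (hC₂ : C ⊆ closedBall (0 : EuclideanSpace ℝ (Fin n)) n) :
    ((n : ℝ) ^ 2)⁻¹ * hausdorffDist K C ≤ hausdorffDist (polarSet K) (polarSet C) ∧
    hausdorffDist (polarSet K) (polarSet C) ≤ (n : ℝ) ^ 2 * hausdorffDist K C := by
  have hn0 : (0 : ℝ) < n := by exact_mod_cast hn
  have h0 : (0 : EuclideanSpace ℝ (Fin n)) ∈ closedBall 0 ((n : ℝ)⁻¹) :=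
    mem_closedBall_self (by positivity)
  refine ⟨?_, hausdorffDist_polar_le hn hK₁ hK₂ hC₁ hC₂⟩
  have h := hausdorffDist_polar_le hn (closedBall_subset_polarSet hn hK₂)
    (polarSet_subset_closedBall hn hK₁) (closedBall_subset_polarSet hn hC₂)
    (polarSet_subset_closedBall hn hC₁)
  rw [polarSet_polarSet hKcomp.isClosed hKconv (hK₁ h0),
    polarSet_polarSet hCcomp.isClosed hCconv (hC₁ h0)] at h
  rw [inv_mul_le_iff₀ (by positivity)]
  exact h

end
end
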